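/- Let G be a simple 3-connected graph in which every 3-separation (A,B) satisfies min{|A|, |B|} ≤ 3. If S is a 5-configuration of G that contains neither three edges forming a triangle of G nor all three edges incident with a vertex of degree 3 of G, then S does not split. -/

import Mathlib

/-!  Common definitions: multigraphs, separations, width, minors,
Kirchhoff/Dodgson polynomials, Feynman 5-splitting, enhanced graphs. -/

noncomputable section

attribute [local instance] Classical.propDecidable

/-- A finite multigraph, given by finite vertex and edge types together with
source and target maps (an arbitrary orientation of each edge). -/
structure Multigraph : Type 1 where
  V : Type
  E : Type
  [fintypeV : Fintype V]
  [fintypeE : Fintype E]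
  src : E → V
  tgt : E → V

attribute [instance] Multigraph.fintypeV Multigraph.fintypeE

namespace Multigraph

variable (G : Multigraph)

/-- The endpoints of an edge as an unordered pair. -/
def ends (e : G.E) : Sym2 G.V := s(G.src e, G.tgt e)

/-- Incidence of a vertex with an edge. -/
def inc (v : G.V) (e : G.E) : Prop := v = G.src e ∨ v = G.tgt e

/-- `V(G_A)`: the vertices of the subgraph induced by an edge set `A`. -/
def edgeVerts (A : Set G.E) : Set G.V := {v | ∃ e ∈ A, G.inc v e}

/-- The order of the separation `(A, Aᶜ)` of the graph `G`,
i.e. `|V(G_A) ∩ V(G_B)|` where `B = Aᶜ`. -/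
def sepOrder (A : Set G.E) : ℕ := (G.edgeVerts A ∩ G.edgeVerts Aᶜ).ncard

/-- One step along an edge belonging to the edge set `A`. -/
def stepOn (A : Set G.E) (a b : G.V) : Prop :=
  ∃ e ∈ A, (G.src e = a ∧ G.tgt e = b) ∨ (G.src e = b ∧ G.tgt e = a)

/-- Reachability using only edges in `A`. -/
def reachOn (A : Set G.E) : G.V → G.V → Prop := Relation.ReflTransGen (G.stepOn A)

/-- Adjacency. -/
def Adj (a b : G.V) : Prop := G.stepOn Set.univ a b

/-- One adjacency step staying inside the vertex set `U`. -/
def stepWithin (U : Set G.V) (a b : G.V) : Prop := a ∈ U ∧ b ∈ U ∧ G.Adj a b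

/-- The subgraph induced by the vertex set `U` is (nonempty and) connected. -/
def ConnectedWithin (U : Set G.V) : Prop :=
  U.Nonempty ∧ ∀ a ∈ U, ∀ b ∈ U, Relation.ReflTransGen (G.stepWithin U) a b

/-- Connectivity of the multigraph. -/
def Connected : Prop := G.ConnectedWithin Set.univ

/-- A multigraph is simple if it has no loops and no parallel edges. -/
def Simple : Prop := (∀ e : G.E, G.src e ≠ G.tgt e) ∧ Function.Injective G.ends

/-- 3-connectivity: at least 4 vertices, and removing fewer than 3 vertices
leaves a connected graph. -/
def ThreeConnected : Prop :=
  4 ≤ Fintype.card G.V ∧ ∀ S : Set G.V, S.ncard < 3 → G.ConnectedWithin Sᶜ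

/-- The spanning subgraph with edge set `T` is connected. -/
def ConnectedOn (T : Set G.E) : Prop := ∀ a b : G.V, G.reachOn T a b

/-- The degree of `v` in the spanning subgraph with edge set `T`
(loops count twice). -/
def degOn (T : Set G.E) (v : G.V) : ℕ :=
  ({e ∈ T | G.src e = v}).ncard + ({e ∈ T | G.tgt e = v}).ncard

/-- The degree of a vertex (loops count twice). -/
def degree (v : G.V) : ℕ := G.degOn Set.univ v

/-- An edge set is a forest (contains no cycle) iff every nonempty subset
has a vertex of degree exactly one. -/
def IsForest (T : Set G.E) : Prop :=
  ∀ T' ⊆ T, T'.Nonempty → ∃ v : G.V, G.degOn T' v = 1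

/-- `T` is the edge set of a spanning tree of `G`. -/
def IsSpanningTree (T : Set G.E) : Prop := G.IsForest T ∧ G.ConnectedOn T

/-- The rank of an edge set in the cycle matroid `M(G)`:
the size of a largest forest contained in it. -/
def rk (A : Set G.E) : ℕ := sSup {n | ∃ T ⊆ A, G.IsForest T ∧ T.ncard = n}

/-- The order of the separation `(A, Aᶜ)` in the cycle matroid `M(G)`,
namely `r(A) + r(Aᶜ) - r(E) + 1`. -/
def msepOrder (A : Set G.E) : ℕ := G.rk A + G.rk Aᶜ + 1 - G.rk Set.univ

/-- The number of connected components of `G_A`, the subgraph induced by the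
edge set `A`. -/
def ncompOn (A : Set G.E) : ℕ :=
  ({C : Set G.V | ∃ v ∈ G.edgeVerts A, C = {w | G.reachOn A v w}}).ncard

/-- `G` has an edge ordering of width at most `k`: every prefix/suffix
separation has order at most `k`. -/
def WidthLE (k : ℕ) : Prop :=
  ∃ f : Fin (Fintype.card G.E) ≃ G.E,
    ∀ ℓ : ℕ,
      G.sepOrder {e | ∃ i : Fin (Fintype.card G.E), f i = e ∧ (i : ℕ) < ℓ} ≤ k

/-- The width of `G`: the minimum width of an edge ordering. -/
def width : ℕ := sInf {k | G.WidthLE k}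

/-- The minor of `G` obtained by deleting the edges in `D` and contracting the
edges in `C`. -/
def minorDC (D C : Set G.E) : Multigraph :=
  let rel : G.V → G.V → Prop := fun a b => ∃ e ∈ C, G.src e = a ∧ G.tgt e = b
  { V := Quot rel
    E := {e : G.E // e ∉ D ∪ C}
    fintypeV := @Fintype.ofFinite _ (Finite.of_surjective (Quot.mk rel) fun q => Quot.exists_rep q)
    fintypeE := Fintype.ofFinite _
    src := fun e => Quot.mk rel (G.src e.1)
    tgt := fun e => Quot.mk rel (G.tgt e.1) }

/-- Deletion of a vertex (together with all incident edges). -/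
def deleteVertex (v : G.V) : Multigraph :=
  { V := {w : G.V // w ≠ v}
    E := {e : G.E // ¬ G.inc v e}
    fintypeV := Fintype.ofFinite _
    fintypeE := Fintype.ofFinite _
    src := fun e => ⟨G.src e.1, fun h => e.2 (Or.inl h.symm)⟩
    tgt := fun e => ⟨G.tgt e.1, fun h => e.2 (Or.inr h.symm)⟩ }

/-- The edges having one endpoint in `X` and the other in `Y`. -/
def crossEdges (X Y : Set G.V) : Set G.E :=
  {e | (G.src e ∈ X ∧ G.tgt e ∈ Y) ∨ (G.src e ∈ Y ∧ G.tgt e ∈ X)}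

/-- `G` has `R` as a minor, via branch sets. -/
def HasMinor (R : Multigraph) : Prop :=
  ∃ X : R.V → Set G.V,
    (∀ v : R.V, G.ConnectedWithin (X v)) ∧
    (Pairwise fun v w => Disjoint (X v) (X w)) ∧
    ∀ v w : R.V, v ≠ w →
      ({f : R.E | R.ends f = s(v, w)}).ncard ≤ (G.crossEdges (X v) (X w)).ncard

/-- `D` is the edge set of a cycle of `G`. -/
def IsCycleSet (D : Set G.E) : Prop :=
  D.Nonempty ∧ (∀ v ∈ G.edgeVerts D, G.degOn D v = 2) ∧
    ∀ a ∈ G.edgeVerts D, ∀ b ∈ G.edgeVerts D, G.reachOn D a b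

/-- The side `A` of a separation on `X` is rich: for every `x ∈ X` there is a
cycle `D` avoiding `x` with at most one edge outside `A`. -/
def Rich (A : Set G.E) (X : Set G.V) : Prop :=
  ∀ x ∈ X, ∃ D : Set G.E, G.IsCycleSet D ∧ x ∉ G.edgeVerts D ∧ (D \ A).ncard ≤ 1

/-- The entry of the (edge × vertex) incidence matrix, as a polynomial. -/
def incCol (e : G.E) (v : G.V) : MvPolynomial G.E ℤ :=
  (if G.src e = v then 1 else 0) - (if G.tgt e = v then 1 else 0)

/-- The expanded Kirchhoff matrix `M_G` (with the column of `v0` deleted). -/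
def bigMatrix (v0 : G.V) :
    Matrix (G.E ⊕ {v : G.V // v ≠ v0}) (G.E ⊕ {v : G.V // v ≠ v0}) (MvPolynomial G.E ℤ) :=
  Matrix.of fun r c =>
    match r, c with
    | Sum.inl e, Sum.inl f => if e = f then MvPolynomial.X e else 0
    | Sum.inl e, Sum.inr v => G.incCol e v.1
    | Sum.inr v, Sum.inl e => - G.incCol e v.1
    | Sum.inr _, Sum.inr _ => 0

/-- The Dodgson polynomial `Ψ^{I,J}_K`: delete the rows indexed by `I` and the
columns indexed by `J` from `M_G`, take the determinant, and set `x_e = 0`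
for `e ∈ K`.  (It is well defined up to an overall sign.) -/
def dodgson (v0 : G.V) (I J K : Set G.E) : MvPolynomial G.E ℤ :=
  if h : Nonempty ({e : G.E // e ∉ I} ≃ {e : G.E // e ∉ J}) then
    MvPolynomial.aeval (fun e => if e ∈ K then (0 : MvPolynomial G.E ℤ) else MvPolynomial.X e)
      (Matrix.det (Matrix.of fun r c =>
        G.bigMatrix v0 (Sum.map Subtype.val id r) (Sum.map (fun x => (h.some x).1) id c)))
  else 0

/-- `(I,J,K)` is one of the 30 Dodgson configurations associated with the
5-configuration `S`. -/
def DodgsonConfig (S I J K : Set G.E) : Prop :=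
  I ∪ J ∪ K = S ∧
    ((I.ncard = 2 ∧ J.ncard = 2 ∧ K.ncard = 1 ∧ I ∩ J = ∅ ∧ I ∩ K = ∅ ∧ J ∩ K = ∅) ∨
      (I.ncard = 3 ∧ J.ncard = 3 ∧ K = ∅ ∧ (I ∩ J).ncard = 1))

/-- The 5-configuration `S` splits: one of its 30 associated Dodgson
polynomials is identically zero. -/
def ConfigSplits (S : Set G.E) : Prop :=
  ∃ I J K : Set G.E, G.DodgsonConfig S I J K ∧ ∀ v0 : G.V, G.dodgson v0 I J K = 0

/-- `G` is Feynman 5-split: every 5-configuration splits. -/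
def FeynmanSplit : Prop := ∀ S : Set G.E, S.ncard = 5 → G.ConfigSplits S

/-- `(U, F)` is a subgraph of `G` (every edge of `F` has both ends in `U`). -/
def IsSubgraphPair (U : Set G.V) (F : Set G.E) : Prop :=
  ∀ e ∈ F, G.src e ∈ U ∧ G.tgt e ∈ U

/-- `G` decomposes into edge-disjoint subgraphs `G₁ ∪ G₂ = G` with
`|V(G₁) ∩ V(G₂)| ≤ 2` and `|E(G₁) ∩ S| = 2`, or with
`|V(G₁) ∩ V(G₂)| = 1` and `|E(G₁) ∩ S| = 1`. -/
def splitWitness (S : Set G.E) : Prop :=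
  ∃ (U1 U2 : Set G.V) (F1 F2 : Set G.E),
    G.IsSubgraphPair U1 F1 ∧ G.IsSubgraphPair U2 F2 ∧
    Disjoint F1 F2 ∧ U1 ∪ U2 = Set.univ ∧ F1 ∪ F2 = Set.univ ∧
    (((U1 ∩ U2).ncard ≤ 2 ∧ (F1 ∩ S).ncard = 2) ∨
      ((U1 ∩ U2).ncard = 1 ∧ (F1 ∩ S).ncard = 1))

/-- A separation of order at most 1 with edges of `S` on both sides, or a
("bad") 2-separation with `min{|A ∩ S|, |B ∩ S|} = 2`. -/
def badSplitSep (S : Set G.E) : Prop :=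
  ∃ A : Set G.E,
    (G.sepOrder A ≤ 1 ∧ (A ∩ S).Nonempty ∧ (Aᶜ ∩ S).Nonempty) ∨
      (G.sepOrder A = 2 ∧ min (A ∩ S).ncard (Aᶜ ∩ S).ncard = 2)

/-- Isomorphism of multigraphs. -/
def IsoTo (G' : Multigraph) : Prop :=
  ∃ (α : G.V ≃ G'.V) (β : G.E ≃ G'.E),
    ∀ e : G.E, G'.ends (β e) = Sym2.map α (G.ends e)

/-- `G` is a tree. -/
def IsTree : Prop := G.Connected ∧ G.IsForest Set.univ

/-- Every vertex has degree 1 or 3. -/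
def IsCubic : Prop := ∀ v : G.V, G.degree v = 1 ∨ G.degree v = 3

/-- A leaf. -/
def IsLeaf (v : G.V) : Prop := G.degree v = 1

/-- A cubic caterpillar: a cubic tree whose non-leaf vertices induce a path. -/
def IsCubicCaterpillar : Prop :=
  G.IsTree ∧ G.IsCubic ∧
    (∀ a ∈ {v : G.V | ¬ G.IsLeaf v}, ∀ b ∈ {v : G.V | ¬ G.IsLeaf v},
      Relation.ReflTransGen (G.stepWithin {v : G.V | ¬ G.IsLeaf v}) a b) ∧
    ∀ v : G.V, ¬ G.IsLeaf v →
      ({e : G.E | G.inc v e ∧ ∃ w : G.V, ¬ G.IsLeaf w ∧ G.inc w e ∧ w ≠ v}).ncard ≤ 2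

/-- The branch decomposition `(T, φ)` of the cycle matroid `M(G)` has width at
most `k`: removing any edge `f` of `T` gives a separation of the ground set
of matroid order at most `k`. -/
def branchWidthLE (T : Multigraph) (φ : G.E → T.V) (k : ℕ) : Prop :=
  ∀ f : T.E,
    G.msepOrder {e : G.E | φ e ∈ {x : T.V | T.reachOn {f}ᶜ (T.src f) x}} ≤ k

/-- `(T, φ)` is a branch decomposition of `M(G)` over a cubic caterpillar. -/
def IsCatDecomp (T : Multigraph) (φ : G.E → T.V) : Prop :=
  T.IsCubicCaterpillar ∧ Function.Injective φ ∧ ∀ e : G.E, T.IsLeaf (φ e)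

/-- The caterpillar width of the cycle matroid `M(G)`. -/
def catWidth : ℕ :=
  sInf {k | ∃ (T : Multigraph) (φ : G.E → T.V), G.IsCatDecomp T φ ∧ G.branchWidthLE T φ k}

end Multigraph

/-! ### Concrete graphs -/

/-- The complete graph `K₅`. -/
def K5m : Multigraph where
  V := Fin 5
  E := {p : Fin 5 × Fin 5 // p.1 < p.2}
  src := fun e => e.1.1
  tgt := fun e => e.1.2

/-- The complete bipartite graph `K₃,₃`. -/
def K33m : Multigraph where
  V := Fin 3 ⊕ Fin 3
  E := Fin 3 × Fin 3
  src := fun e => Sum.inl e.1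
  tgt := fun e => Sum.inr e.2

/-- The cube (3-dimensional hypercube) graph `C`. -/
def cubeM : Multigraph where
  V := Fin 2 × Fin 2 × Fin 2
  E := Fin 3 × Fin 2 × Fin 2
  src := fun e =>
    if e.1 = 0 then (0, e.2.1, e.2.2) else if e.1 = 1 then (e.2.1, 0, e.2.2)
      else (e.2.1, e.2.2, 0)
  tgt := fun e =>
    if e.1 = 0 then (1, e.2.1, e.2.2) else if e.1 = 1 then (e.2.1, 1, e.2.2)
      else (e.2.1, e.2.2, 1)

/-- The octahedron graph `O = K₂,₂,₂`. -/
def octaM : Multigraph where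
  V := Fin 3 × Fin 2
  E := {p : (Fin 3 × Fin 2) × (Fin 3 × Fin 2) // p.1.1 < p.2.1}
  src := fun e => e.1.1
  tgt := fun e => e.1.2

/-- The edges of the graph `H` (the cube after a Y–Δ transformation at one
vertex): vertices `0,1,2` form the new triangle, `6` is the antipodal vertex. -/
def hEdgeList : List (Fin 7 × Fin 7) :=
  [(0,1), (0,2), (1,2), (0,3), (0,4), (1,3), (1,5), (2,4), (2,5), (3,6), (4,6), (5,6)]

/-- The graph `H`, one Δ–Y away from each of the cube and the octahedron. -/
def Hm : Multigraph where
  V := Fin 7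
  E := {p : Fin 7 × Fin 7 // p ∈ hEdgeList}
  src := fun e => e.1.1
  tgt := fun e => e.1.2

/-- The complete graph `K₄`. -/
def K4m : Multigraph where
  V := Fin 4
  E := {p : Fin 4 × Fin 4 // p.1 < p.2}
  src := fun e => e.1.1
  tgt := fun e => e.1.2

/-- `K₅⁻`, the complete graph on 5 vertices minus the edge `{3,4}`. -/
def K5minusM : Multigraph where
  V := Fin 5
  E := {p : Fin 5 × Fin 5 // p.1 < p.2 ∧ ¬(p.1 = 3 ∧ p.2 = 4)}
  src := fun e => e.1.1
  tgt := fun e => e.1.2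

/-- The wheel `W_k`: centre `none`; rim edges `Sum.inl i` join `some i` to
`some (i+1)`, spoke edges `Sum.inr i` join the centre to `some i`. -/
def wheelM (k : ℕ) : Multigraph where
  V := Option (Fin k)
  E := Fin k ⊕ Fin k
  src := Sum.elim (fun i => some i) (fun _ => none)
  tgt := Sum.elim (fun i => some (finRotate k i)) (fun i => some i)

/-! ### Enhanced graphs -/

/-- An enhanced graph: a graph together with sets of contract-proof and
delete-proof edges. -/
structure EGraph : Type 1 where
  G : Multigraph
  Cp : Set G.E
  Dp : Set G.E

namespace EGraph

/-- The 5-configuration `S` of an enhanced graph splits. -/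
def Splits (H : EGraph) (S : Set H.G.E) : Prop :=
  H.G.badSplitSep S ∨
    (∃ f ∈ S \ H.Dp, (H.G.minorDC {f} ∅).badSplitSep {e | e.1 ∈ S}) ∨
    (∃ f ∈ S \ H.Cp, (H.G.minorDC ∅ {f}).badSplitSep {e | e.1 ∈ S})

/-- An enhanced graph is non-split if it has a non-split 5-configuration. -/
def NonSplit (H : EGraph) : Prop := ∃ S : Set H.G.E, S.ncard = 5 ∧ ¬ H.Splits S

/-- Deletion of an edge. -/
def delE (H : EGraph) (f : H.G.E) : EGraph :=
  ⟨H.G.minorDC {f} ∅, {e | e.1 ∈ H.Cp}, {e | e.1 ∈ H.Dp}⟩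

/-- Contraction of an edge. -/
def conE (H : EGraph) (f : H.G.E) : EGraph :=
  ⟨H.G.minorDC ∅ {f}, {e | e.1 ∈ H.Cp}, {e | e.1 ∈ H.Dp}⟩

/-- Deletion of a vertex. -/
def delV (H : EGraph) (v : H.G.V) : EGraph :=
  ⟨H.G.deleteVertex v, {e | e.1 ∈ H.Cp}, {e | e.1 ∈ H.Dp}⟩

/-- Remove an edge from the contract-proof set. -/
def unprotC (H : EGraph) (f : H.G.E) : EGraph := ⟨H.G, H.Cp \ {f}, H.Dp⟩

/-- Remove an edge from the delete-proof set. -/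
def unprotD (H : EGraph) (f : H.G.E) : EGraph := ⟨H.G, H.Cp, H.Dp \ {f}⟩

/-- Delete `f'` of a parallel pair `f, f'` and make `f` delete-proof. -/
def parallelReduce (H : EGraph) (f f' : H.G.E) : EGraph :=
  ⟨H.G.minorDC {f'} ∅, {e | e.1 ∈ H.Cp}, {e | e.1 ∈ H.Dp ∨ e.1 = f}⟩

/-- Contract `f'` of the two edges `f, f'` at a degree-two vertex and make
`f` contract-proof. -/
def seriesReduce (H : EGraph) (f f' : H.G.E) : EGraph :=
  ⟨H.G.minorDC ∅ {f'}, {e | e.1 ∈ H.Cp ∨ e.1 = f}, {e | e.1 ∈ H.Dp}⟩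

/-- One step of the enhanced-graph minor relation. -/
inductive MinorStep : EGraph → EGraph → Prop
  | delV (H : EGraph) (v : H.G.V) : MinorStep H (H.delV v)
  | delE (H : EGraph) (f : H.G.E) : MinorStep H (H.delE f)
  | conE (H : EGraph) (f : H.G.E) : MinorStep H (H.conE f)
  | unprotC (H : EGraph) (f : H.G.E) (hf : f ∈ H.Cp) : MinorStep H (H.unprotC f)
  | unprotD (H : EGraph) (f : H.G.E) (hf : f ∈ H.Dp) : MinorStep H (H.unprotD f)
  | parallel (H : EGraph) (f f' : H.G.E) (hne : f ≠ f')
      (hpar : H.G.ends f = H.G.ends f') : MinorStep H (H.parallelReduce f f')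
  | series (H : EGraph) (f f' : H.G.E) (v : H.G.V) (hne : f ≠ f')
      (hf : H.G.inc v f) (hf' : H.G.inc v f')
      (hdeg : ∀ e : H.G.E, H.G.inc v e → e = f ∨ e = f') :
      MinorStep H (H.seriesReduce f f')

/-- Minor-minimal non-split enhanced graph: non-split, but every proper
enhanced minor is split. -/
def MinorMinimalNonSplit (H : EGraph) : Prop :=
  H.NonSplit ∧ ∀ H' : EGraph, Relation.TransGen MinorStep H H' → ¬ H'.NonSplit

/-- Isomorphism of enhanced graphs. -/
def IsoTo (H H' : EGraph) : Prop :=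
  ∃ (α : H.G.V ≃ H'.G.V) (β : H.G.E ≃ H'.G.E),
    (∀ e : H.G.E, H'.G.ends (β e) = Sym2.map α (H.G.ends e)) ∧
    (∀ e : H.G.E, β e ∈ H'.Cp ↔ e ∈ H.Cp) ∧
    (∀ e : H.G.E, β e ∈ H'.Dp ↔ e ∈ H.Dp)

end EGraph

/-- The edge `01` of `K₄`. -/
def e01K4 : K4m.E := ⟨(0, 1), by decide⟩

/-- The enhanced graph `K₄(1)`: all edges of `K₄` except one are both
contract-proof and delete-proof. -/
def K4one : EGraph := ⟨K4m, {e | e ≠ e01K4}, {e | e ≠ e01K4}⟩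

/-! ### The statement -/

open Multigraph

theorem exists_linking {α : Type*} {r : Set α → ℤ} (hmono : Monotone r)
    (hsub : ∀ A B, r (A ∪ B) + r (A ∩ B) ≤ r A + r B)
    (hunit : ∀ a A, r (insert a A) ≤ r A + 1) (X Y : Set α) (t : ℤ) {F : Set α}
    (hF : F.Finite) :
    ∀ U₀ : Set α, (∀ A ⊆ F, t + r U₀ + r (U₀ ∪ F ∪ X ∪ Y) ≤
        r (U₀ ∪ A ∪ X) + r (U₀ ∪ (F \ A) ∪ Y)) →
      ∃ U ⊆ F, r (U₀ ∪ U) = r U₀ + U.ncard ∧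
        t + r (U₀ ∪ U) + r (U₀ ∪ U ∪ X ∪ Y) ≤ r (U₀ ∪ U ∪ X) + r (U₀ ∪ U ∪ Y) := by
  induction F, hF using Set.Finite.induction_on with
  | empty =>
    intro U₀ h
    refine ⟨∅, subset_rfl, by simp, ?_⟩
    simpa using h ∅ subset_rfl
  | @insert f F hfF hF ih =>
    intro U₀ h
    by_cases hf : r (insert f U₀) ≤ r U₀
    · have habs : ∀ Z, r (insert f (U₀ ∪ Z)) ≤ r (U₀ ∪ Z) := by
        intro Z
        have h1 := hsub (insert f U₀) (U₀ ∪ Z)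
        have h2 : r U₀ ≤ r (insert f U₀ ∩ (U₀ ∪ Z)) := hmono (by grind)
        have h3 : r (insert f (U₀ ∪ Z)) ≤ r (insert f U₀ ∪ (U₀ ∪ Z)) := hmono (by grind)
        linarith
      obtain ⟨U, hU, h1, h2⟩ := ih U₀ fun A hA => by
        have h1 := h A (hA.trans (Set.subset_insert _ _))
        have h2 : r (U₀ ∪ F ∪ X ∪ Y) ≤ r (U₀ ∪ insert f F ∪ X ∪ Y) := hmono (by grind)
        have h3 : r (U₀ ∪ (insert f F \ A) ∪ Y) ≤ r (insert f (U₀ ∪ ((F \ A) ∪ Y))) :=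
          hmono (by grind)
        have h4 := habs ((F \ A) ∪ Y)
        rw [← Set.union_assoc U₀] at h4 h3
        linarith
      exact ⟨U, hU.trans (Set.subset_insert _ _), h1, h2⟩
    by_cases hdel : ∀ A ⊆ F, t + r U₀ + r (U₀ ∪ F ∪ X ∪ Y) ≤
        r (U₀ ∪ A ∪ X) + r (U₀ ∪ (F \ A) ∪ Y)
    · obtain ⟨U, hU, h1, h2⟩ := ih U₀ hdel
      exact ⟨U, hU.trans (Set.subset_insert _ _), h1, h2⟩
    by_cases hcon : ∀ A ⊆ F, t + r (insert f U₀) + r (insert f U₀ ∪ F ∪ X ∪ Y) ≤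
        r (insert f U₀ ∪ A ∪ X) + r (insert f U₀ ∪ (F \ A) ∪ Y)
    · obtain ⟨U, hU, h1, h2⟩ := ih (insert f U₀) hcon
      have hfU : f ∉ U := fun h => hfF (hU h)
      have hins : insert f U₀ ∪ U = U₀ ∪ insert f U := by grind
      rw [hins] at h1 h2
      refine ⟨insert f U, Set.insert_subset_insert hU, ?_, h2⟩
      rw [Set.ncard_insert_of_notMem hfU (hF.subset hU), h1]
      have := hunit f U₀
      push_cast
      omega
    exfalso
    push Not at hdel hcon
    obtain ⟨A₁, hA₁, h1⟩ := hdel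
    obtain ⟨A₂, hA₂, h2⟩ := hcon
    have s1 := hsub (U₀ ∪ A₁ ∪ X) (insert f U₀ ∪ A₂ ∪ X)
    have s2 := hsub (U₀ ∪ (F \ A₁) ∪ Y) (insert f U₀ ∪ (F \ A₂) ∪ Y)
    have l1 := h (A₁ ∩ A₂) (by grind)
    have l2 := h (insert f (A₁ ∪ A₂)) (by grind)
    have m1 : r (U₀ ∪ A₁ ∩ A₂ ∪ X) ≤ r ((U₀ ∪ A₁ ∪ X) ∩ (insert f U₀ ∪ A₂ ∪ X)) :=
      hmono (by grind)
    have m2 : r (U₀ ∪ insert f (A₁ ∪ A₂) ∪ X) ≤ r ((U₀ ∪ A₁ ∪ X) ∪ (insert f U₀ ∪ A₂ ∪ X)) :=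
      hmono (by grind)
    have m3 : r (U₀ ∪ (insert f F \ insert f (A₁ ∪ A₂)) ∪ Y) ≤
        r ((U₀ ∪ (F \ A₁) ∪ Y) ∩ (insert f U₀ ∪ (F \ A₂) ∪ Y)) := hmono (by grind)
    have m4 : r (U₀ ∪ (insert f F \ (A₁ ∩ A₂)) ∪ Y) ≤
        r ((U₀ ∪ (F \ A₁) ∪ Y) ∪ (insert f U₀ ∪ (F \ A₂) ∪ Y)) := hmono (by grind)
    have m5 : r (U₀ ∪ F ∪ X ∪ Y) ≤ r (U₀ ∪ insert f F ∪ X ∪ Y) := hmono (by grind)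
    have m6 : r (insert f U₀ ∪ F ∪ X ∪ Y) = r (U₀ ∪ insert f F ∪ X ∪ Y) :=
      congrArg r (by grind)
    have := hunit f U₀
    linarith

namespace Multigraph

variable {G : Multigraph}

theorem ThreeConnected.exists_crossing (h3 : G.ThreeConnected) {X Z : Set G.V}
    (hZ : Z.ncard < 3) {x y : G.V} (hx : x ∈ X) (hxZ : x ∉ Z) (hy : y ∉ X) (hyZ : y ∉ Z) :
    ∃ e u w, u ∈ X ∧ u ∉ Z ∧ w ∉ X ∧ w ∉ Z ∧
      ((G.src e = u ∧ G.tgt e = w) ∨ (G.src e = w ∧ G.tgt e = u)) := by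
  by_contra hcon
  refine hy ?_
  have hpath := (h3.2 Z hZ).2 x hxZ y hyZ
  clear hyZ hy
  induction hpath with
  | refl => exact hx
  | @tail b c _ hbc ih =>
    obtain ⟨hb, hc, e, _, he⟩ := hbc
    by_contra hcX
    exact hcon ⟨e, b, c, ih, hb, hcX, hc, he⟩

theorem ThreeConnected.three_le_ncard_inc (h3 : G.ThreeConnected) (hs : G.Simple) (v : G.V) :
    3 ≤ {e | G.inc v e}.ncard := by
  by_contra hlt
  set other : G.E → G.V := fun e => if G.src e = v then G.tgt e else G.src e with hother
  set Z : Set G.V := other '' {e | G.inc v e} with hZdef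
  have hZ : Z.ncard < 3 := (Set.ncard_image_le (Set.toFinite _)).trans_lt (by omega)
  have hvZ : v ∉ Z := by
    rintro ⟨e, he, hev⟩
    have := hs.1 e
    simp only [hother] at hev
    split_ifs at hev with h
    · exact this (h.trans hev.symm)
    · exact h hev
  have hne : (insert v Z)ᶜ.Nonempty := by
    rw [Set.nonempty_compl]
    intro h
    have h1 : (insert v Z).ncard ≤ Z.ncard + 1 := Set.ncard_insert_le _ _
    rw [h, Set.ncard_univ, Nat.card_eq_fintype_card] at h1
    have := h3.1
    omega
  obtain ⟨y, hy⟩ := hne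
  obtain ⟨e, u, w, hu, -, -, hw, he⟩ := h3.exists_crossing (X := {v}) hZ (x := v) (y := y) rfl hvZ
    (fun h => hy (Or.inl h)) (fun h => hy (Or.inr h))
  obtain rfl : u = v := hu
  refine hw ?_
  rcases he with ⟨h1, h2⟩ | ⟨h1, h2⟩
  · exact ⟨e, Or.inl h1.symm, by simp [hother, h1, h2]⟩
  · refine ⟨e, Or.inr h2.symm, ?_⟩
    have := hs.1 e
    simp only [hother]
    rw [if_neg (fun h => this (h.trans h2.symm)), h1]

/-- Edge sets inside a vertex set with at most two elements have at most one element. -/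
theorem Simple.ncard_le_one (hs : G.Simple) {X : Set G.V} (hX : X.ncard ≤ 2) {A : Set G.E}
    (hA : ∀ e ∈ A, G.src e ∈ X ∧ G.tgt e ∈ X) : A.ncard ≤ 1 := by
  rw [Set.ncard_le_one]
  intro e he f hf
  have key : ∀ e ∈ A, X = {G.src e, G.tgt e} := by
    intro e he
    symm
    apply Set.eq_of_subset_of_ncard_le
    · rintro x (rfl | rfl)
      exacts [(hA e he).1, (hA e he).2]
    · rwa [Set.ncard_pair (hs.1 e)]
    · exact Set.toFinite _
  have h := (key e he).symm.trans (key f hf)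
  refine hs.2 ?_
  simp only [ends]
  rw [Sym2.eq_iff]
  exact Set.pair_eq_pair_iff.1 h

end Multigraph

namespace Multigraph

variable {G : Multigraph}

/-- The functions on the vertices that are constant along the edges of `A`. -/
def potentials (G : Multigraph) (A : Set G.E) : Submodule ℚ (G.V → ℚ) where
  carrier := {β | ∀ e ∈ A, β (G.src e) = β (G.tgt e)}
  add_mem' := fun ha hb e he => by simp [ha e he, hb e he]
  zero_mem' := fun _ _ => rfl
  smul_mem' := fun c _ ha e he => by simp [ha e he]

theorem mem_potentials {A : Set G.E} {β : G.V → ℚ} :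
    β ∈ G.potentials A ↔ ∀ e ∈ A, β (G.src e) = β (G.tgt e) := Iff.rfl

theorem potentials_anti {A B : Set G.E} (h : A ⊆ B) : G.potentials B ≤ G.potentials A :=
  fun _ hβ e he => hβ e (h he)

/-- The number of connected components of the spanning subgraph with edge set `A`. -/
def numComp (G : Multigraph) (A : Set G.E) : ℕ := Module.finrank ℚ (G.potentials A)

/-- The rank of `A` in the cycle matroid, defined through potentials. -/
def cycRank (G : Multigraph) (A : Set G.E) : ℤ := Fintype.card G.V - G.numComp A

theorem numComp_anti {A B : Set G.E} (h : A ⊆ B) : G.numComp B ≤ G.numComp A :=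
  Submodule.finrank_mono (potentials_anti h)

theorem cycRank_mono : Monotone G.cycRank := fun A B h => by
  have := numComp_anti h
  simp only [cycRank]
  omega

theorem cycRank_submodular (A B : Set G.E) :
    G.cycRank (A ∪ B) + G.cycRank (A ∩ B) ≤ G.cycRank A + G.cycRank B := by
  have h1 := Submodule.finrank_sup_add_finrank_inf_eq (G.potentials A) (G.potentials B)
  have h2 : G.potentials (A ∪ B) = G.potentials A ⊓ G.potentials B := by
    ext β
    simp only [Submodule.mem_inf, mem_potentials, Set.mem_union]
    grind
  have h3 : Module.finrank ℚ ↥(G.potentials A ⊔ G.potentials B) ≤ G.numComp (A ∩ B) :=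
    Submodule.finrank_mono
      (sup_le (potentials_anti Set.inter_subset_left) (potentials_anti Set.inter_subset_right))
  rw [← h2] at h1
  simp only [cycRank, numComp] at *
  omega

theorem cycRank_insert_le (e : G.E) (A : Set G.E) :
    G.cycRank (insert e A) ≤ G.cycRank A + 1 := by
  let φ : (G.V → ℚ) →ₗ[ℚ] ℚ :=
    LinearMap.proj (R := ℚ) (φ := fun _ => ℚ) (G.src e) -
      LinearMap.proj (R := ℚ) (φ := fun _ => ℚ) (G.tgt e)
  let ψ : G.potentials A →ₗ[ℚ] ℚ := φ.comp (G.potentials A).subtype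
  have h1 := ψ.finrank_range_add_finrank_ker
  have h2 : Module.finrank ℚ (LinearMap.range ψ) ≤ 1 := by
    simpa using Submodule.finrank_le (LinearMap.range ψ)
  have h3 : Module.finrank ℚ (LinearMap.ker ψ) ≤ G.numComp (insert e A) := by
    rw [← Submodule.finrank_map_subtype_eq]
    refine Submodule.finrank_mono ?_
    rintro β ⟨γ, hγ, rfl⟩ f hf
    rcases hf with rfl | hf
    · simpa [ψ, φ, sub_eq_zero] using hγ
    · exact γ.2 f hf
  simp only [cycRank, numComp] at *
  omega

theorem cycRank_empty : G.cycRank ∅ = 0 := by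
  have : G.potentials ∅ = ⊤ := by
    ext β
    simp [mem_potentials]
  rw [cycRank, numComp, this, finrank_top]
  simp

theorem cycRank_union_le (A B : Set G.E) : G.cycRank (A ∪ B) ≤ G.cycRank A + B.ncard := by
  induction B, B.toFinite using Set.Finite.induction_on with
  | empty => simp
  | @insert e B he hB ih =>
    rw [Set.ncard_insert_of_notMem he hB, Set.union_insert]
    have := cycRank_insert_le e (A ∪ B)
    push_cast
    omega

theorem cycRank_le_ncard (A : Set G.E) : G.cycRank A ≤ A.ncard := by
  simpa [cycRank_empty] using cycRank_union_le ∅ A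

/-- A vertex set respected by `A` but not by `e` shows that `e` is independent of `A`. -/
theorem cycRank_lt_cycRank_insert {A : Set G.E} {e : G.E} (X : Set G.V)
    (hA : ∀ f ∈ A, G.src f ∈ X ↔ G.tgt f ∈ X) (he : ¬ (G.src e ∈ X ↔ G.tgt e ∈ X)) :
    G.cycRank A + 1 ≤ G.cycRank (insert e A) := by
  have hlt : G.potentials (insert e A) < G.potentials A := by
    refine lt_of_le_of_ne (potentials_anti (Set.subset_insert _ _)) fun h => ?_
    have h1 : X.indicator 1 ∈ G.potentials A := fun f hf => by
      have := hA f hf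
      by_cases h : G.src f ∈ X <;> simp_all
    rw [← h] at h1
    have h2 := h1 e (Set.mem_insert _ _)
    by_cases h : G.src e ∈ X <;> by_cases h' : G.tgt e ∈ X <;> simp_all
  have := Submodule.finrank_lt_finrank_of_lt hlt
  simp only [cycRank, numComp]
  omega

/-- The components of the spanning subgraph with edge set `A`. -/
abbrev Comp (G : Multigraph) (A : Set G.E) : Type :=
  Quot fun a b : G.V => ∃ e ∈ A, G.src e = a ∧ G.tgt e = b

theorem Comp.mk_eq {A : Set G.E} {e : G.E} (he : e ∈ A) :
    (Quot.mk _ (G.src e) : G.Comp A) = Quot.mk _ (G.tgt e) :=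
  Quot.sound ⟨e, he, rfl, rfl⟩

instance (A : Set G.E) : Finite (G.Comp A) :=
  Finite.of_surjective (Quot.mk _) Quot.mk_surjective

theorem numComp_eq_card (A : Set G.E) : G.numComp A = Nat.card (G.Comp A) := by
  have := Fintype.ofFinite (G.Comp A)
  let L : (G.Comp A → ℚ) ≃ₗ[ℚ] G.potentials A :=
    { toFun := fun f => ⟨fun v => f (Quot.mk _ v), fun e he => congrArg f (Comp.mk_eq he)⟩
      map_add' := fun _ _ => rfl
      map_smul' := fun _ _ => rfl
      invFun := fun β => Quot.lift β.1 (by rintro _ _ ⟨e, he, rfl, rfl⟩; exact β.2 e he)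
      left_inv := fun f => by
        ext ⟨v⟩
        rfl
      right_inv := fun β => rfl }
  rw [numComp, ← L.finrank_eq, Module.finrank_fintype_fun_eq_card, Nat.card_eq_fintype_card]

/-- Edges inside a nonempty vertex set `X` have rank at most `|X| - 1`. -/
theorem cycRank_inside_le {A : Set G.E} {X : Set G.V} (hX : X.Nonempty)
    (hA : ∀ e ∈ A, G.src e ∈ X ∧ G.tgt e ∈ X) : G.cycRank A ≤ X.ncard - 1 := by
  let f : G.Comp A → Option ↥Xᶜ := Quot.lift
    (fun v => if h : v ∈ X then none else some ⟨v, h⟩)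
    (by
      rintro _ _ ⟨e, he, rfl, rfl⟩
      simp [hA e he])
  have hf : Function.Surjective f := by
    rintro (_ | ⟨v, hv⟩)
    · obtain ⟨x, hx⟩ := hX
      exact ⟨Quot.mk _ x, by simp [f, hx]⟩
    · exact ⟨Quot.mk _ v, by
        have : v ∉ X := hv
        simp [f, this]⟩
  have h1 := Nat.card_le_card_of_surjective f hf
  rw [Finite.card_option, Nat.card_coe_set_eq] at h1
  have h2 := Set.ncard_add_ncard_compl X
  rw [Nat.card_eq_fintype_card] at h2
  rw [cycRank, numComp_eq_card]
  omega

end Multigraph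

namespace Multigraph

variable {G : Multigraph}

theorem src_mem_edgeVerts {A : Set G.E} {e : G.E} (he : e ∈ A) : G.src e ∈ G.edgeVerts A :=
  ⟨e, he, Or.inl rfl⟩

theorem tgt_mem_edgeVerts {A : Set G.E} {e : G.E} (he : e ∈ A) : G.tgt e ∈ G.edgeVerts A :=
  ⟨e, he, Or.inr rfl⟩

/-- The vertices of the subgraph induced by `A` lying in the component `c`. -/
def block (A : Set G.E) (c : G.Comp A) : Set G.V := {v ∈ G.edgeVerts A | Quot.mk _ v = c}

theorem src_mem_block_iff {A : Set G.E} {c : G.Comp A} {e : G.E} (he : e ∈ A) :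
    G.src e ∈ block A c ↔ G.tgt e ∈ block A c := by
  simp only [block, Set.mem_ofPred_eq, src_mem_edgeVerts he, tgt_mem_edgeVerts he, true_and,
    Comp.mk_eq he]

/-- The boundary vertices of `A` lying on components of `A` that consist of a single edge. -/
def linkVerts (A : Set G.E) : Set G.V :=
  {v ∈ G.edgeVerts A ∩ G.edgeVerts Aᶜ | (block A (Quot.mk _ v)).ncard = 2}

theorem block_dichotomy (h3 : G.ThreeConnected) (hs : G.Simple) {A : Set G.E}
    (hB : 2 ≤ Aᶜ.ncard) {v : G.V} (hv : v ∈ G.edgeVerts A) :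
    3 ≤ (block A (Quot.mk _ v) ∩ G.edgeVerts Aᶜ).ncard ∨
      ((block A (Quot.mk _ v)).ncard = 2 ∧ block A (Quot.mk _ v) ⊆ G.edgeVerts Aᶜ) := by
  set X := block A (Quot.mk _ v) with hX
  have hclosed : ∀ e ∈ A, G.src e ∈ X ↔ G.tgt e ∈ X := fun e he => src_mem_block_iff he
  have hvX : v ∈ X := ⟨hv, rfl⟩
  have htwo : 2 ≤ X.ncard := by
    obtain ⟨e, he, hve⟩ := hv
    have h := hclosed e he
    have hsub : ({G.src e, G.tgt e} : Set G.V) ⊆ X := by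
      rintro x (rfl | rfl) <;> rcases hve with hve | hve <;> grind
    rw [← Set.ncard_pair (hs.1 e)]
    exact Set.ncard_le_ncard hsub
  by_cases hsub : X ⊆ G.edgeVerts Aᶜ
  · rw [Set.inter_eq_left.2 hsub]
    have := hsub
    by_cases h : X.ncard = 2
    · exact Or.inr ⟨h, hsub⟩
    · exact Or.inl (by omega)
  · left
    by_contra hlt
    obtain ⟨x, hx, hxB⟩ := Set.not_subset.1 hsub
    by_cases hu : ∃ y, y ∉ X
    · obtain ⟨y, hy⟩ := hu
      obtain ⟨e, u, w, huX, huZ, hwX, -, he⟩ :=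
        h3.exists_crossing (X := X) (Z := X ∩ G.edgeVerts Aᶜ) (by omega) hx
          (fun h => hxB h.2) hy (fun h => hy h.1)
      have huB : u ∉ G.edgeVerts Aᶜ := fun h => huZ ⟨huX, h⟩
      by_cases heA : e ∈ A
      · have := hclosed e heA
        rcases he with ⟨rfl, rfl⟩ | ⟨rfl, rfl⟩ <;> tauto
      · refine huB ⟨e, heA, ?_⟩
        rcases he with ⟨rfl, rfl⟩ | ⟨rfl, rfl⟩ <;> simp [inc]
    · push Not at hu
      rw [Set.inter_eq_right.2 (fun y _ => hu y)] at hlt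
      have := hs.ncard_le_one (X := G.edgeVerts Aᶜ) (A := Aᶜ) (by omega)
        (fun e he => ⟨src_mem_edgeVerts he, tgt_mem_edgeVerts he⟩)
      omega

theorem block_subset_linkVerts (h3 : G.ThreeConnected) (hs : G.Simple) {A : Set G.E}
    (hB : 2 ≤ Aᶜ.ncard) {v : G.V} (hv : v ∈ linkVerts A) :
    block A (Quot.mk _ v) ⊆ linkVerts A := by
  have hsub : block A (Quot.mk _ v) ⊆ G.edgeVerts Aᶜ := by
    rcases block_dichotomy h3 hs hB hv.1.1 with h | h
    · have := Set.ncard_inter_le_ncard_left (block A (Quot.mk _ v)) (G.edgeVerts Aᶜ)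
      have := hv.2
      omega
    · exact h.2
  intro w hw
  refine ⟨⟨hw.1, hsub hw⟩, ?_⟩
  rw [hw.2]
  exact hv.2

theorem src_mem_linkVerts_iff (h3 : G.ThreeConnected) (hs : G.Simple) {A : Set G.E}
    (hB : 2 ≤ Aᶜ.ncard) {e : G.E} (he : e ∈ A) :
    G.src e ∈ linkVerts A ↔ G.tgt e ∈ linkVerts A := by
  constructor <;> intro h
  · exact block_subset_linkVerts h3 hs hB h ⟨tgt_mem_edgeVerts he, (Comp.mk_eq he).symm⟩
  · exact block_subset_linkVerts h3 hs hB h ⟨src_mem_edgeVerts he, Comp.mk_eq he⟩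

theorem linkVerts_degree_le (hs : G.Simple) {A : Set G.E} {v : G.V} (hv : v ∈ linkVerts A) :
    {e ∈ A | G.inc v e}.ncard ≤ 1 := by
  refine hs.ncard_le_one (X := block A (Quot.mk _ v)) hv.2.le ?_
  rintro e ⟨he, rfl | rfl⟩
  · exact ⟨⟨src_mem_edgeVerts he, rfl⟩, tgt_mem_edgeVerts he, (Comp.mk_eq he).symm⟩
  · exact ⟨⟨src_mem_edgeVerts he, Comp.mk_eq he⟩, tgt_mem_edgeVerts he, rfl⟩

theorem disjoint_linkVerts (h3 : G.ThreeConnected) (hs : G.Simple) (A : Set G.E) :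
    Disjoint (linkVerts A) (linkVerts Aᶜ) := by
  rw [Set.disjoint_left]
  intro v h1 h2
  have hdeg := h3.three_le_ncard_inc hs v
  have h : {e | G.inc v e} = {e ∈ A | G.inc v e} ∪ {e ∈ Aᶜ | G.inc v e} := by
    ext e
    by_cases he : e ∈ A <;> simp [he]
  have h' := Set.ncard_union_le {e ∈ A | G.inc v e} {e ∈ Aᶜ | G.inc v e}
  rw [← h] at h'
  have := linkVerts_degree_le hs h1
  have := linkVerts_degree_le hs h2
  omega

/-- Counting the components of the subgraph induced by `A`: there are `p` of them, `s` of which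
consist of a single edge. -/
theorem component_counts (h3 : G.ThreeConnected) (hs : G.Simple) {A : Set G.E}
    (hB : 2 ≤ Aᶜ.ncard) : ∃ p s : ℕ, G.numComp A ≤ p + (G.edgeVerts A)ᶜ.ncard ∧
      3 * p ≤ G.sepOrder A + s ∧ (linkVerts A).ncard = 2 * s ∧ s ≤ p ∧
      (s = p → A.ncard ≤ s) := by
  have hfin := Fintype.ofFinite (G.Comp A)
  let q : G.V → G.Comp A := Quot.mk _
  let P : Finset (G.Comp A) := (G.edgeVerts A).toFinset.image q
  let Q : Finset (G.Comp A) := {c ∈ P | (block A c).ncard = 2}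
  let V₀ : Finset G.V := (G.edgeVerts A ∩ G.edgeVerts Aᶜ).toFinset
  have hfib : ∀ c, ({v ∈ V₀ | q v = c} : Finset G.V).card =
      (block A c ∩ G.edgeVerts Aᶜ).ncard := by
    intro c
    rw [← Set.ncard_coe_finset]
    congr 1
    ext v
    simp [V₀, q, block]
    tauto
  have hdich : ∀ c ∈ P, 3 ≤ (block A c ∩ G.edgeVerts Aᶜ).ncard ∨
      ((block A c).ncard = 2 ∧ block A c ⊆ G.edgeVerts Aᶜ) := by
    intro c hc
    obtain ⟨v, hv, rfl⟩ := Finset.mem_image.1 hc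
    exact block_dichotomy h3 hs hB (by simpa using hv)
  refine ⟨P.card, Q.card, ?_, ?_, ?_, Finset.card_filter_le _ _, ?_⟩
  · rw [numComp_eq_card, Nat.card_eq_fintype_card, ← Finset.card_univ]
    have hcov : (Finset.univ : Finset (G.Comp A)) ⊆ P ∪ (G.edgeVerts A)ᶜ.toFinset.image q := by
      rintro ⟨v⟩ -
      by_cases hv : v ∈ G.edgeVerts A
      · exact Finset.mem_union_left _ (Finset.mem_image_of_mem q (by simpa using hv))
      · exact Finset.mem_union_right _ (Finset.mem_image_of_mem q (by simpa using hv))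
    refine (Finset.card_le_card hcov).trans ((Finset.card_union_le _ _).trans ?_)
    rw [Set.ncard_eq_toFinset_card']
    exact Nat.add_le_add_left Finset.card_image_le _
  · have hm : G.sepOrder A = ∑ c ∈ P, (block A c ∩ G.edgeVerts Aᶜ).ncard := by
      rw [sepOrder, Set.ncard_eq_toFinset_card']
      rw [Finset.card_eq_sum_card_fiberwise (f := q) (t := P)]
      · exact Finset.sum_congr rfl fun c _ => hfib c
      · intro v hv
        simp only [Set.coe_toFinset] at hv
        exact Finset.mem_coe.2 (Finset.mem_image_of_mem q (by simpa using hv.1))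
    rw [hm, Finset.card_filter, ← Finset.sum_add_distrib, mul_comm, ← smul_eq_mul]
    refine Finset.card_nsmul_le_sum _ _ _ fun c hc => ?_
    rcases hdich c hc with h | ⟨h, h'⟩
    · omega
    · rw [Set.inter_eq_left.2 h', h, if_pos rfl]
  · rw [Set.ncard_eq_toFinset_card', Finset.card_eq_sum_card_fiberwise (f := q) (t := Q)]
    · rw [Finset.sum_const_nat (m := 2), mul_comm]
      intro c hc
      obtain ⟨hcP, hc2⟩ := Finset.mem_filter.1 hc
      have hsub : block A c ⊆ G.edgeVerts Aᶜ := by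
        rcases hdich c hcP with h | h
        · have := Set.ncard_inter_le_ncard_left (block A c) (G.edgeVerts Aᶜ)
          omega
        · exact h.2
      rw [← hc2, ← Set.ncard_coe_finset]
      congr 1
      ext v
      simp only [Finset.coe_filter, Set.mem_toFinset, Set.mem_ofPred_eq]
      constructor
      · rintro ⟨h1, h2⟩
        exact ⟨h1.1.1, h2⟩
      · intro h
        refine ⟨⟨⟨h.1, hsub h⟩, ?_⟩, h.2⟩
        rw [h.2]
        exact hc2
    · intro v hv
      simp only [Set.coe_toFinset] at hv
      refine Finset.mem_coe.2 (Finset.mem_filter.2 ⟨Finset.mem_image_of_mem q ?_, hv.2⟩)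
      simpa using hv.1.1
  · intro hQP
    have hQ : Q = P := Finset.eq_of_subset_of_card_le (Finset.filter_subset _ _) hQP.ge
    rw [← Set.ncard_coe_finset]
    refine Set.ncard_le_ncard_of_injOn (fun e => q (G.src e)) ?_ ?_ (Set.toFinite _)
    · intro e he
      rw [hQ]
      exact Finset.mem_coe.2 (Finset.mem_image_of_mem q (by simpa using src_mem_edgeVerts he))
    · intro e he f hf hef
      have hc : q (G.src e) ∈ Q := by
        rw [hQ]
        exact Finset.mem_image_of_mem q (by simpa using src_mem_edgeVerts he)
      have hle := hs.ncard_le_one (X := block A (q (G.src e))) (A := {e, f})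
        (Finset.mem_filter.1 hc).2.le (by
          rintro g (rfl | rfl)
          · exact ⟨⟨src_mem_edgeVerts he, rfl⟩, tgt_mem_edgeVerts he, (Comp.mk_eq he).symm⟩
          · exact ⟨⟨src_mem_edgeVerts hf, hef.symm⟩, tgt_mem_edgeVerts hf,
              (Comp.mk_eq hf).symm.trans hef.symm⟩)
      exact (Set.ncard_le_one).1 hle e (by simp) f (by simp)

theorem sepOrder_compl (A : Set G.E) : G.sepOrder Aᶜ = G.sepOrder A := by
  rw [sepOrder, sepOrder, compl_compl, Set.inter_comm]

/-- A separation of the cycle matroid of order at most three with at least four edges on both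
sides is a 3-separation of the graph. -/
theorem sepOrder_le_three (h3 : G.ThreeConnected) (hs : G.Simple) {A : Set G.E}
    (hr : G.cycRank A + G.cycRank Aᶜ ≤ Fintype.card G.V + 1) (hA : 4 ≤ A.ncard)
    (hB : 4 ≤ Aᶜ.ncard) : G.sepOrder A ≤ 3 := by
  obtain ⟨p, s, h1, h2, h4, h5, h6⟩ := component_counts h3 hs (A := A) (by omega)
  obtain ⟨p', s', h1', h2', h4', h5', h6'⟩ := component_counts h3 hs (A := Aᶜ)
    (by rw [compl_compl]; omega)
  rw [sepOrder_compl] at h2'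
  have hcover : G.edgeVerts A ∪ G.edgeVerts Aᶜ = Set.univ := by
    refine Set.eq_univ_of_forall fun v => ?_
    have hpos : 0 < {e | G.inc v e}.ncard := by
      have := h3.three_le_ncard_inc hs v
      omega
    obtain ⟨e, he⟩ := Set.nonempty_of_ncard_ne_zero hpos.ne'
    by_cases heA : e ∈ A
    · exact Or.inl ⟨e, heA, he⟩
    · exact Or.inr ⟨e, heA, he⟩
  have hsum : (G.edgeVerts A)ᶜ.ncard + (G.edgeVerts Aᶜ)ᶜ.ncard + G.sepOrder A =
      Fintype.card G.V := by
    have e1 := Set.ncard_union_add_ncard_inter (G.edgeVerts A) (G.edgeVerts Aᶜ)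
    have e2 := Set.ncard_add_ncard_compl (G.edgeVerts A)
    have e3 := Set.ncard_add_ncard_compl (G.edgeVerts Aᶜ)
    rw [hcover, Set.ncard_univ, Nat.card_eq_fintype_card] at e1
    rw [Nat.card_eq_fintype_card] at e2 e3
    rw [sepOrder]
    omega
  have hdis := disjoint_linkVerts h3 hs A
  have hsub : linkVerts A ∪ linkVerts Aᶜ ⊆ G.edgeVerts A ∩ G.edgeVerts Aᶜ := by
    rintro v (hv | hv)
    · exact hv.1
    · have := hv.1
      rw [compl_compl] at this
      exact this.symm
  have hcard : (linkVerts A ∪ linkVerts Aᶜ).ncard = 2 * s + 2 * s' := by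
    rw [Set.ncard_union_eq hdis, h4, h4']
  have hle := Set.ncard_le_ncard hsub
  rw [hcard] at hle
  change _ ≤ G.sepOrder A at hle
  have hlink : 1 ≤ s → 1 ≤ s' → 2 * s + 2 * s' + 3 ≤ G.sepOrder A := by
    intro hs1 hs1'
    by_contra hlt
    obtain ⟨y, hy⟩ := Set.nonempty_of_ncard_ne_zero (s := linkVerts A) (by omega)
    obtain ⟨x, hx⟩ := Set.nonempty_of_ncard_ne_zero (s := linkVerts Aᶜ) (by omega)
    set Z := (G.edgeVerts A ∩ G.edgeVerts Aᶜ) \ (linkVerts A ∪ linkVerts Aᶜ) with hZ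
    have hZcard : Z.ncard < 3 := by
      rw [hZ, Set.ncard_sdiff hsub, hcard]
      change G.sepOrder A - _ < 3
      omega
    have hxA : x ∈ G.edgeVerts A := (hsub (Or.inr hx)).1
    obtain ⟨e, u, w, hu, huZ, hw, -, he⟩ := h3.exists_crossing
      (X := G.edgeVerts A \ linkVerts A) hZcard (x := x) (y := y)
      ⟨hxA, fun h => hdis.le_bot ⟨h, hx⟩⟩ (fun h => h.2 (Or.inr hx)) (fun h => h.2 hy)
      (fun h => h.2 (Or.inl hy))
    by_cases heA : e ∈ A
    · have := src_mem_linkVerts_iff h3 hs (A := A) (by omega) heA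
      have := src_mem_edgeVerts heA
      have := tgt_mem_edgeVerts heA
      rcases he with ⟨rfl, rfl⟩ | ⟨rfl, rfl⟩ <;> simp only [Set.mem_sdiff] at hu hw <;> tauto
    · have key := src_mem_linkVerts_iff h3 hs (A := Aᶜ) (by rw [compl_compl]; omega) heA
      have hs' := src_mem_edgeVerts (A := Aᶜ) heA
      have ht' := tgt_mem_edgeVerts (A := Aᶜ) heA
      have hwl : w ∈ linkVerts Aᶜ := by
        simp only [Set.mem_sdiff, hZ, Set.mem_inter_iff, Set.mem_union] at hu huZ
        rcases he with ⟨rfl, rfl⟩ | ⟨rfl, rfl⟩ <;> tauto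
      exact hw ⟨(hsub (Or.inr hwl)).1, fun h => hdis.le_bot ⟨h, hwl⟩⟩
  simp only [cycRank] at hr
  by_contra hm
  have : ¬ (1 ≤ s ∧ 1 ≤ s') := by
    rintro ⟨h, h'⟩
    have := hlink h h'
    omega
  omega

end Multigraph

namespace Multigraph

variable {G : Multigraph}

/-- The edges with both ends in `X`. -/
def inside (G : Multigraph) (X : Set G.V) : Set G.E := {e | G.src e ∈ X ∧ G.tgt e ∈ X}

theorem three_mul_ncard_le (h3 : G.ThreeConnected) (hs : G.Simple) (X : Set G.V) :
    3 * X.ncard ≤ 2 * (G.inside X).ncard + (G.crossEdges X Xᶜ).ncard := by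
  have hcount := Finset.sum_card_bipartiteAbove_eq_sum_card_bipartiteBelow
    (s := X.toFinset) (t := (Finset.univ : Finset G.E)) G.inc
  have hlow : 3 * X.ncard ≤ ∑ v ∈ X.toFinset, (Finset.univ.bipartiteAbove G.inc v).card := by
    rw [Set.ncard_eq_toFinset_card', mul_comm, ← smul_eq_mul]
    refine Finset.card_nsmul_le_sum _ _ _ fun v _ => ?_
    have := h3.three_le_ncard_inc hs v
    rwa [Set.ncard_eq_toFinset_card', Set.toFinset_ofPred] at this
  have hup : ∑ e : G.E, (X.toFinset.bipartiteBelow G.inc e).card ≤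
      ∑ e : G.E, (2 * (if e ∈ G.inside X then 1 else 0) +
        if e ∈ G.crossEdges X Xᶜ then 1 else 0) := by
    refine Finset.sum_le_sum fun e _ => ?_
    have hsub : X.toFinset.bipartiteBelow G.inc e ⊆ ({G.src e, G.tgt e} : Finset G.V).filter
        (· ∈ X) := by
      intro v hv
      simp only [Finset.mem_bipartiteBelow, Set.mem_toFinset, inc] at hv
      simp [hv]
    refine (Finset.card_le_card hsub).trans ?_
    have hne := hs.1 e
    by_cases h1 : G.src e ∈ X <;> by_cases h2 : G.tgt e ∈ X <;>
      simp [Finset.filter_insert, Finset.filter_singleton, h1, h2, inside, crossEdges,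
        Finset.card_pair hne]
  rw [hcount] at hlow
  refine (hlow.trans hup).trans ?_
  rw [Finset.sum_add_distrib, ← Finset.mul_sum, ← Finset.card_filter, ← Finset.card_filter,
    Set.ncard_eq_toFinset_card', Set.ncard_eq_toFinset_card']
  refine le_of_eq ?_
  congr 3 <;> · ext; simp

theorem inside_union (X : Set G.V) :
    (G.inside X ∪ G.crossEdges X Xᶜ)ᶜ = G.inside Xᶜ := by
  ext e
  simp only [inside, crossEdges, Set.mem_compl_iff, Set.mem_union, Set.mem_ofPred_eq]
  tauto

theorem degree_eq_ncard (hs : G.Simple) (v : G.V) : G.degree v = {e | G.inc v e}.ncard := by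
  rw [degree, degOn, ← Set.ncard_union_eq]
  · congr 1
    ext e
    simp [inc, eq_comm]
  · rw [Set.disjoint_left]
    rintro e ⟨-, h1⟩ ⟨-, h2⟩
    exact hs.1 e (h1.trans h2.symm)

theorem crossEdges_comm (X Y : Set G.V) : G.crossEdges X Y = G.crossEdges Y X := by
  ext e
  simp only [crossEdges, Set.mem_ofPred_eq]
  tauto

/-- A vertex set whose edge boundary lies in a set `T` of three edges containing no
degree-three star has at least three vertices. -/
theorem three_le_ncard_of_cut (h3 : G.ThreeConnected) (hs : G.Simple) {T : Set G.E}
    (hT : T.ncard ≤ 3) (hstar : ¬ ∃ v : G.V, G.degree v = 3 ∧ {e | G.inc v e} ⊆ T)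
    {X : Set G.V} (hX : X.Nonempty) (hcut : G.crossEdges X Xᶜ ⊆ T) : 3 ≤ X.ncard := by
  have hsum := three_mul_ncard_le h3 hs X
  have hcard := (Set.ncard_le_ncard hcut).trans hT
  have hpos : 0 < X.ncard := (Set.ncard_pos (Set.toFinite _)).2 hX
  by_contra hlt
  have hin : (G.inside X).ncard ≤ 1 := hs.ncard_le_one (by omega) fun e he => he
  have hone : X.ncard = 1 := by omega
  obtain ⟨x, rfl⟩ := Set.ncard_eq_one.1 hone
  have hinc : {e | G.inc x e} ⊆ G.crossEdges {x} {x}ᶜ := by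
    rintro e (rfl | rfl)
    · exact Or.inl ⟨rfl, fun h => hs.1 e h.symm⟩
    · exact Or.inr ⟨fun h => hs.1 e h, rfl⟩
  refine hstar ⟨x, ?_, hinc.trans hcut⟩
  rw [degree_eq_ncard hs]
  exact le_antisymm ((Set.ncard_le_ncard hinc).trans hcard) (h3.three_le_ncard_inc hs x)

/-- Deleting three edges that do not form a degree-three star keeps the graph connected. -/
theorem numComp_compl_le_one (h3 : G.ThreeConnected) (hs : G.Simple)
    (hsep : ∀ A : Set G.E, G.sepOrder A ≤ 3 → min A.ncard Aᶜ.ncard ≤ 3) {T : Set G.E}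
    (hT : T.ncard ≤ 3) (hstar : ¬ ∃ v : G.V, G.degree v = 3 ∧ {e | G.inc v e} ⊆ T) :
    G.numComp Tᶜ ≤ 1 := by
  rw [numComp_eq_card, Finite.card_le_one_iff_subsingleton]
  by_contra hsub
  rw [not_subsingleton_iff_nontrivial] at hsub
  obtain ⟨⟨x⟩, ⟨y⟩, hxy⟩ := hsub
  set X : Set G.V := {v | (Quot.mk _ v : G.Comp Tᶜ) = Quot.mk _ x} with hXdef
  have hx : x ∈ X := rfl
  have hy : y ∉ X := fun h => hxy h.symm
  have hcut : G.crossEdges X Xᶜ ⊆ T := by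
    intro e he
    by_contra heT
    have h := Comp.mk_eq (A := Tᶜ) heT
    simp only [crossEdges, hXdef, Set.mem_ofPred_eq, Set.mem_compl_iff, h] at he
    tauto
  have hcut' : G.crossEdges Xᶜ Xᶜᶜ ⊆ T := by rwa [compl_compl, crossEdges_comm]
  have hXc := three_le_ncard_of_cut h3 hs hT hstar ⟨x, hx⟩ hcut
  have hYc := three_le_ncard_of_cut h3 hs hT hstar ⟨y, hy⟩ hcut'
  have hsX := three_mul_ncard_le h3 hs X
  have hsY := three_mul_ncard_le h3 hs Xᶜ
  rw [compl_compl, crossEdges_comm] at hsY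
  have ht := (Set.ncard_le_ncard hcut).trans hT
  obtain ⟨f, u, w, hu, -, hw, -, hf⟩ := h3.exists_crossing (X := X) (Z := ∅) (by simp) hx
    (Set.notMem_empty _) hy (Set.notMem_empty _)
  have hfc : f ∈ G.crossEdges X Xᶜ := by
    rcases hf with ⟨rfl, rfl⟩ | ⟨rfl, rfl⟩
    · exact Or.inl ⟨hu, hw⟩
    · exact Or.inr ⟨hw, hu⟩
  have hfX : f ∉ G.inside X := by
    rintro ⟨h1, h2⟩
    rcases hfc with h | h
    · exact h.2 h2
    · exact h.1 h1
  have hcompl : (insert f (G.inside X))ᶜ = G.inside Xᶜ ∪ (G.crossEdges X Xᶜ \ {f}) := by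
    rw [← inside_union]
    have hd : ∀ e ∈ G.inside X, e ∉ G.crossEdges X Xᶜ := by
      rintro e ⟨h1, h2⟩ (h | h)
      · exact h.2 h2
      · exact h.1 h1
    ext e
    simp only [Set.mem_compl_iff, Set.mem_insert_iff, Set.mem_union, Set.mem_sdiff,
      Set.mem_singleton_iff]
    have := hd e
    by_cases hef : e = f
    · subst hef
      simp_all
    · by_cases h1 : e ∈ G.inside X <;> by_cases h2 : e ∈ G.crossEdges X Xᶜ <;> simp_all
  have hdisj : Disjoint (G.inside Xᶜ) (G.crossEdges X Xᶜ \ {f}) := by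
    rw [Set.disjoint_left]
    rintro e ⟨h1, h2⟩ ⟨h | h, -⟩
    · exact h1 h.1
    · exact h2 h.2
  have hdiff := Set.ncard_sdiff_singleton_add_one hfc
  have hA4 : 4 ≤ (insert f (G.inside X)).ncard := by
    rw [Set.ncard_insert_of_notMem hfX]
    omega
  have hB4 : 4 ≤ (insert f (G.inside X))ᶜ.ncard := by
    rw [hcompl, Set.ncard_union_eq hdisj]
    omega
  have hr1 := cycRank_insert_le f (G.inside X)
  have hr2 := cycRank_inside_le (A := G.inside X) ⟨x, hx⟩ fun e he => he
  have hr3 := cycRank_union_le (G.inside Xᶜ) (G.crossEdges X Xᶜ \ {f})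
  have hr4 := cycRank_inside_le (A := G.inside Xᶜ) ⟨y, hy⟩ fun e he => he
  rw [← hcompl] at hr3
  have hn := Set.ncard_add_ncard_compl X
  rw [Nat.card_eq_fintype_card] at hn
  have hle := hsep _ (sepOrder_le_three h3 hs (by omega) hA4 hB4)
  omega

theorem two_le_cycRank_pair (hs : G.Simple) {a b : G.E} (hab : a ≠ b) : 2 ≤ G.cycRank {b, a} := by
  have h1 : 1 ≤ G.cycRank {a} := by
    have := cycRank_lt_cycRank_insert (A := ∅) (e := a) {G.src a} (by simp)
      (by simpa using (hs.1 a).symm)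
    rw [cycRank_empty] at this
    simpa using this
  have hne : G.ends a ≠ G.ends b := fun h => hab (hs.2 h)
  have ha := hs.1 a
  have hb := hs.1 b
  simp only [ends, ne_eq, Sym2.eq_iff] at hne
  by_cases h : G.src b = G.src a ∨ G.src b = G.tgt a
  · have := cycRank_lt_cycRank_insert (A := {a}) (e := b) {G.tgt b} (by simp; grind)
      (by simpa using hb)
    omega
  · have := cycRank_lt_cycRank_insert (A := {a}) (e := b) {G.src b} (by simp; grind)
      (by simpa using Ne.symm hb)
    omega

/-- Three distinct edges not forming a triangle are independent. -/
theorem three_le_cycRank_triple (hs : G.Simple) {a b e : G.E} (hab : a ≠ b) (hae : a ≠ e) (hbe : b ≠ e)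
    (htri : ¬ ∃ x y z : G.V, x ≠ y ∧ x ≠ z ∧ y ≠ z ∧
      G.ends e = s(x, y) ∧ G.ends a = s(y, z) ∧ G.ends b = s(x, z)) :
    3 ≤ G.cycRank {e, b, a} := by
  have h2 := two_le_cycRank_pair hs hab
  have ha := hs.1 a
  have hb := hs.1 b
  have he := hs.1 e
  have hne1 : G.ends a ≠ G.ends e := fun h => hae (hs.2 h)
  have hne2 : G.ends b ≠ G.ends e := fun h => hbe (hs.2 h)
  simp only [ends, ne_eq, Sym2.eq_iff] at hne1 hne2
  suffices h : ∃ X : Set G.V, (G.src a ∈ X ↔ G.tgt a ∈ X) ∧ (G.src b ∈ X ↔ G.tgt b ∈ X) ∧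
      ¬ (G.src e ∈ X ↔ G.tgt e ∈ X) by
    obtain ⟨X, hXa, hXb, hXe⟩ := h
    have := cycRank_lt_cycRank_insert (A := {b, a}) (e := e) X
      (by rintro f (rfl | rfl) <;> assumption) hXe
    omega
  by_contra hcon
  push Not at hcon
  have c1 := hcon {G.src e}
  have c2 := hcon {G.tgt e}
  have c3 := hcon {G.src a, G.tgt a}
  have c4 := hcon {G.src b, G.tgt b}
  simp only [Set.mem_singleton_iff, Set.mem_insert_iff] at c1 c2 c3 c4
  simp only [ends, Sym2.eq_iff] at htri
  have t1 := fun h => htri ⟨G.src e, G.tgt e, G.src a, h⟩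
  have t2 := fun h => htri ⟨G.src e, G.tgt e, G.tgt a, h⟩
  have t3 := fun h => htri ⟨G.tgt e, G.src e, G.src a, h⟩
  have t4 := fun h => htri ⟨G.tgt e, G.src e, G.tgt a, h⟩
  clear hcon htri c4 h2 hab hae hbe hs
  generalize G.src a = a₁, G.tgt a = a₂, G.src b = b₁, G.tgt b = b₂,
    G.src e = e₁, G.tgt e = e₂ at *
  by_cases h₁ : a₁ = e₁ <;> by_cases h₂ : a₁ = e₂ <;> by_cases h₃ : a₂ = e₁ <;>
    by_cases h₄ : a₂ = e₂ <;> by_cases h₅ : b₁ = e₁ <;> by_cases h₆ : b₁ = e₂ <;>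
    by_cases h₇ : b₂ = e₁ <;> by_cases h₈ : b₂ = e₂ <;> grind (splits := 20)

end Multigraph

namespace Multigraph

variable {G : Multigraph}

/-- The entry of the incidence matrix of `G` over the rationals. -/
def bd (G : Multigraph) (e : G.E) (v : G.V) : ℚ :=
  (if G.src e = v then 1 else 0) - (if G.tgt e = v then 1 else 0)

theorem sum_bd_mul (e : G.E) (β : G.V → ℚ) :
    ∑ v, G.bd e v * β v = β (G.src e) - β (G.tgt e) := by
  simp [bd, sub_mul, Finset.sum_sub_distrib]

/-- A current without sources away from `v0` is orthogonal to every potential vanishing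
at `v0`. -/
theorem sum_mul_potential_eq_zero {α : G.E → ℚ} {β : G.V → ℚ} {v0 : G.V} (hβ : β v0 = 0)
    (hα : ∀ v, v ≠ v0 → ∑ e, G.bd e v * α e = 0) :
    ∑ e, α e * (β (G.src e) - β (G.tgt e)) = 0 := by
  simp_rw [← sum_bd_mul, Finset.mul_sum]
  rw [Finset.sum_comm]
  refine Finset.sum_eq_zero fun v _ => ?_
  by_cases hv : v = v0
  · simp [hv, hβ]
  · rw [← zero_mul (β v), ← hα v hv, Finset.sum_mul]
    exact Finset.sum_congr rfl fun e _ => by ring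

/-- A forest carries no nonzero current without sources. -/
theorem eq_zero_of_forest {C : Set G.E} (hC : G.cycRank C = C.ncard) {α : G.E → ℚ} {v0 : G.V}
    (hαC : ∀ e ∉ C, α e = 0) (hα : ∀ v, v ≠ v0 → ∑ e, G.bd e v * α e = 0) : α = 0 := by
  let δ : (G.V → ℚ) →ₗ[ℚ] (C → ℚ) :=
    { toFun := fun β e => β (G.src e) - β (G.tgt e)
      map_add' := fun β γ => by ext; simp; ring
      map_smul' := fun c β => by ext; simp; ring }
  have hker : LinearMap.ker δ = G.potentials C := by
    ext β
    simp [δ, mem_potentials, funext_iff, sub_eq_zero]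
  have hrank := δ.finrank_range_add_finrank_ker
  rw [hker, Module.finrank_fintype_fun_eq_card] at hrank
  have hsurj : LinearMap.range δ = ⊤ := by
    apply Submodule.eq_top_of_finrank_eq
    rw [Module.finrank_fintype_fun_eq_card, ← Nat.card_eq_fintype_card, Nat.card_coe_set_eq]
    simp only [cycRank, numComp] at hC
    omega
  obtain ⟨γ, hγ⟩ := LinearMap.range_eq_top.1 hsurj fun e => α e
  have h := sum_mul_potential_eq_zero (β := fun v => γ v - γ v0) (sub_self _) hα
  have hsq : ∀ e, α e * ((γ (G.src e) - γ v0) - (γ (G.tgt e) - γ v0)) = α e * α e := by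
    intro e
    by_cases he : e ∈ C
    · have := congrFun hγ ⟨e, he⟩
      simp only [δ, LinearMap.coe_mk, AddHom.coe_mk] at this
      rw [← this]
      ring
    · simp [hαC e he]
  rw [Finset.sum_congr rfl fun e _ => hsq e,
    Finset.sum_eq_zero_iff_of_nonneg fun e _ => mul_self_nonneg _] at h
  funext e
  simpa using h e (Finset.mem_univ e)

theorem potentials_constant {A : Set G.E} (hA : G.numComp A ≤ 1) {β : G.V → ℚ}
    (hβ : β ∈ G.potentials A) {v0 : G.V} (h0 : β v0 = 0) : β = 0 := by
  rw [numComp_eq_card, Finite.card_le_one_iff_subsingleton] at hA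
  let f : G.Comp A → ℚ := Quot.lift β (by rintro _ _ ⟨e, he, rfl, rfl⟩; exact hβ e he)
  funext v
  exact (congrArg f (Subsingleton.elim (Quot.mk _ v) (Quot.mk _ v0))).trans h0

/-- The linear system given by the specialised Dodgson matrix has only the zero solution. -/
theorem dodgson_system_trivial {I J U : Set G.E} (hU : Disjoint U (I ∪ J))
    (hC : G.cycRank (U ∪ (I \ J)) = (U ∪ (I \ J)).ncard)
    (hpot : G.potentials (U ∪ (J \ I)) ≤ G.potentials (I \ J))
    (hconn : G.numComp (I ∩ J)ᶜ ≤ 1) {v0 : G.V} {α : G.E → ℚ} {β : G.V → ℚ} (hβ : β v0 = 0)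
    (hαJ : ∀ e ∈ J, α e = 0) (hα : ∀ v, v ≠ v0 → ∑ e, G.bd e v * α e = 0)
    (hrow : ∀ e ∉ I, (if e ∈ U then 0 else α e) + (β (G.src e) - β (G.tgt e)) = 0) :
    α = 0 ∧ β = 0 := by
  have hβU : β ∈ G.potentials (U ∪ (J \ I)) := by
    rintro e (he | ⟨heJ, heI⟩)
    · have := hrow e fun h => Set.disjoint_left.1 hU he (Or.inl h)
      simpa [he, sub_eq_zero] using this
    · have := hrow e heI
      simpa [hαJ e heJ, sub_eq_zero] using this
  have hβI := hpot hβU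
  have horth := sum_mul_potential_eq_zero hβ hα
  have hterm : ∀ e, α e * (β (G.src e) - β (G.tgt e)) =
      -(if e ∈ U ∪ I ∪ J then 0 else α e * α e) := by
    intro e
    split_ifs with he
    · rcases he with (he | he) | he
      · simp [hβU e (Or.inl he)]
      · by_cases heJ : e ∈ J
        · simp [hαJ e heJ]
        · simp [hβI e ⟨he, heJ⟩]
      · simp [hαJ e he]
    · simp only [Set.mem_union, not_or] at he
      have := hrow e he.1.2
      rw [if_neg he.1.1] at this
      rw [eq_neg_of_add_eq_zero_right this]
      ring
  simp_rw [hterm, Finset.sum_neg_distrib, neg_eq_zero] at horth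
  rw [Finset.sum_eq_zero_iff_of_nonneg fun e _ => by
    split_ifs
    · exact le_rfl
    · exact mul_self_nonneg _] at horth
  have hα0 : ∀ e ∉ U ∪ I ∪ J, α e = 0 := fun e he => by
    simpa [he] using horth e (Finset.mem_univ e)
  constructor
  · refine eq_zero_of_forest hC (fun e he => ?_) hα
    by_cases heJ : e ∈ J
    · exact hαJ e heJ
    · refine hα0 e fun h => he ?_
      rcases h with (h | h) | h
      · exact Or.inl h
      · exact Or.inr ⟨h, heJ⟩
      · exact absurd h heJ
  · refine potentials_constant hconn (fun e he => ?_) hβ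
    by_cases heU : e ∈ U ∪ (J \ I)
    · exact hβU e heU
    · by_cases heI : e ∈ I
      · exact hβI e ⟨heI, fun h => he ⟨heI, h⟩⟩
      · have heU' : e ∉ U := fun h => heU (Or.inl h)
        have heJ : e ∉ J := fun h => heU (Or.inr ⟨h, heI⟩)
        have := hrow e heI
        rw [hα0 e (by simp [heU', heI, heJ])] at this
        simpa [sub_eq_zero] using this

/-- A criterion for the Dodgson polynomial to be nonzero. -/
theorem dodgson_ne_zero {I J K U : Set G.E} (hIJ : I.ncard = J.ncard) (hKU : K ⊆ U)
    (hU : Disjoint U (I ∪ J)) (hC : G.cycRank (U ∪ (I \ J)) = (U ∪ (I \ J)).ncard)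
    (hpot : G.potentials (U ∪ (J \ I)) ≤ G.potentials (I \ J))
    (hconn : G.numComp (I ∩ J)ᶜ ≤ 1) (v0 : G.V) : G.dodgson v0 I J K ≠ 0 := by
  have hne : Nonempty ({e : G.E // e ∉ I} ≃ {e : G.E // e ∉ J}) := by
    have h1 := Set.ncard_add_ncard_compl I
    have h2 := Set.ncard_add_ncard_compl J
    have h3 : Nat.card ↥Iᶜ = Nat.card ↥Jᶜ := by
      rw [Nat.card_coe_set_eq, Nat.card_coe_set_eq]
      omega
    exact Finite.card_eq.1 h3
  intro hzero
  rw [dodgson, dif_pos hne] at hzero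
  generalize hne.some = σ at hzero
  let φ : MvPolynomial G.E ℤ →+* ℚ :=
    MvPolynomial.eval₂Hom (Int.castRingHom ℚ) fun e => if e ∈ U then 0 else 1
  have hφ : φ.comp (MvPolynomial.aeval (R := ℤ) fun e =>
      if e ∈ K then (0 : MvPolynomial G.E ℤ) else MvPolynomial.X e).toRingHom = φ := by
    apply MvPolynomial.ringHom_ext
    · intro r
      simp [φ]
    · intro e
      by_cases he : e ∈ K
      · simp [φ, he, hKU he]
      · simp [φ, he]
  have hinc : ∀ e v, φ (G.incCol e v) = G.bd e v := by
    intro e v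
    simp only [incCol, bd, map_sub]
    split_ifs <;> simp
  have hdet := congrArg φ hzero
  rw [map_zero] at hdet
  replace hdet := (RingHom.congr_fun hφ _).symm.trans hdet
  rw [RingHom.map_det] at hdet
  obtain ⟨w, hw0, hw⟩ := Matrix.exists_mulVec_eq_zero_iff.2 hdet
  let α : G.E → ℚ := fun e => if h : e ∉ J then w (Sum.inl (σ.symm ⟨e, h⟩)) else 0
  let β : G.V → ℚ := fun v => if h : v ≠ v0 then w (Sum.inr ⟨v, h⟩) else 0
  have hsumα : ∀ f : G.E → ℚ, ∑ x, f (σ x).1 * w (Sum.inl x) = ∑ e, f e * α e := by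
    intro f
    rw [← Fintype.sum_subtype_add_sum_subtype (fun e => e ∉ J), ← σ.sum_comp,
      Finset.sum_eq_zero (s := (Finset.univ : Finset {e // ¬ e ∉ J})) fun e _ => by
        simp [α, not_not.1 e.2], add_zero]
    refine Finset.sum_congr rfl fun x _ => ?_
    simp [α, (σ x).2]
  have hsumβ : ∀ f : G.V → ℚ, ∑ v : {v // v ≠ v0}, f v.1 * w (Sum.inr v) = ∑ v, f v * β v := by
    intro f
    rw [← Fintype.sum_subtype_add_sum_subtype (fun v => v ≠ v0),
      Finset.sum_eq_zero (s := (Finset.univ : Finset {v // ¬ v ≠ v0})) fun v _ => by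
        simp [β, not_not.1 v.2], add_zero]
    refine Finset.sum_congr rfl fun v _ => ?_
    simp [β, v.2]
  obtain ⟨hα, hβ⟩ := dodgson_system_trivial (v0 := v0) (α := α) (β := β) hU hC hpot hconn
    (by simp [β]) (fun e he => by simp [α, he])
    (fun v hv => by
      have := congrFun hw (Sum.inr ⟨v, hv⟩)
      simp only [Matrix.mulVec, dotProduct, Fintype.sum_sum_type, RingHom.mapMatrix_apply,
        Matrix.map_apply, Matrix.of_apply, bigMatrix, Sum.map_inl, Sum.map_inr, id, map_neg,
        map_zero, hinc, zero_mul, Finset.sum_const_zero, add_zero, Pi.zero_apply] at this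
      rw [hsumα fun e => -G.bd e v] at this
      simpa using this)
    (fun e he => by
      have := congrFun hw (Sum.inl ⟨e, he⟩)
      simp only [Matrix.mulVec, dotProduct, Fintype.sum_sum_type, RingHom.mapMatrix_apply,
        Matrix.map_apply, Matrix.of_apply, bigMatrix, Sum.map_inl, Sum.map_inr, id,
        hinc, Pi.zero_apply] at this
      rw [hsumα fun f => φ (if e = f then MvPolynomial.X e else 0), hsumβ fun v => G.bd e v,
        sum_bd_mul, Finset.sum_eq_single e] at this
      · by_cases heU : e ∈ U <;> simpa [φ, heU] using this
      · intro f _ hf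
        simp [Ne.symm hf]
      · simp)
  apply hw0
  funext c
  rcases c with x | v
  · have := congrFun hα (σ x).1
    simpa [α, (σ x).2] using this
  · have := congrFun hβ v.1
    simpa [β, v.2] using this

end Multigraph

namespace Multigraph

variable {G : Multigraph}

theorem cycRank_le_card_sub_one [Nonempty G.V] (A : Set G.E) :
    G.cycRank A ≤ Fintype.card G.V - 1 := by
  have := cycRank_inside_le (A := A) (X := Set.univ) Set.univ_nonempty (by simp)
  rwa [Set.ncard_univ, Nat.card_eq_fintype_card] at this

/-- Linking `I \ J` to `J \ I` outside the configuration makes the Dodgson polynomial nonzero. -/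
theorem dodgson_ne_zero_of_connectivity {I J K : Set G.E} (hIJ : I.ncard = J.ncard)
    (hX : (I \ J).ncard = 2) (hK : G.cycRank K = K.ncard) (hKd : Disjoint K (I ∪ J))
    (hconn : G.numComp (I ∩ J)ᶜ ≤ 1) (v0 : G.V)
    (h : ∀ A ⊆ (I ∪ J ∪ K)ᶜ,
      2 + G.cycRank K + G.cycRank (K ∪ (I ∪ J ∪ K)ᶜ ∪ (I \ J) ∪ (J \ I)) ≤
        G.cycRank (K ∪ A ∪ (I \ J)) + G.cycRank (K ∪ ((I ∪ J ∪ K)ᶜ \ A) ∪ (J \ I))) :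
    G.dodgson v0 I J K ≠ 0 := by
  obtain ⟨U, hUF, hr, ht⟩ := exists_linking cycRank_mono cycRank_submodular cycRank_insert_le
    (I \ J) (J \ I) 2 (Set.toFinite (I ∪ J ∪ K)ᶜ) K h
  have hUd : Disjoint U (I ∪ J) :=
    Set.disjoint_left.2 fun e he h' => hUF he (Or.inl h')
  have hKUd : Disjoint K U := Set.disjoint_left.2 fun e he h' => hUF h' (Or.inr he)
  have hd : Disjoint (K ∪ U) (I ∪ J) := Set.disjoint_union_left.2 ⟨hKd, hUd⟩
  have h1 := cycRank_union_le (K ∪ U) (I \ J)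
  have h2 : G.cycRank (K ∪ U ∪ (J \ I)) ≤ G.cycRank (K ∪ U ∪ (I \ J) ∪ (J \ I)) :=
    cycRank_mono (Set.union_subset_union_left _ Set.subset_union_left)
  have hcard : (K ∪ U ∪ (I \ J)).ncard = K.ncard + U.ncard + 2 := by
    rw [Set.ncard_union_eq (hd.mono_right (Set.sdiff_subset.trans Set.subset_union_left)),
      Set.ncard_union_eq hKUd, hX]
  refine dodgson_ne_zero hIJ Set.subset_union_left hd (by omega) ?_ hconn v0
  have hle : G.potentials (K ∪ U ∪ (I \ J) ∪ (J \ I)) ≤ G.potentials (K ∪ U ∪ (J \ I)) :=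
    potentials_anti (Set.union_subset_union_left _ Set.subset_union_left)
  rw [← Submodule.eq_of_le_of_finrank_eq hle]
  · exact potentials_anti (Set.subset_union_right.trans Set.subset_union_left)
  · simp only [cycRank, numComp] at *
    omega

theorem cycRank_singleton (hs : G.Simple) (e : G.E) : G.cycRank {e} = 1 := by
  have h1 := cycRank_lt_cycRank_insert (A := ∅) (e := e) {G.src e} (by simp)
    (by simpa using (hs.1 e).symm)
  have h2 := cycRank_le_ncard {e}
  rw [cycRank_empty] at h1
  simp only [Set.ncard_singleton, insert_empty_eq] at h1 h2
  omega

theorem Simple.card_edges_le (hs : G.Simple) :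
    Fintype.card G.E ≤ (Fintype.card G.V).choose 2 := by
  rw [← Sym2.card_subtype_not_diag]
  exact Fintype.card_le_of_injective
    (fun e => (⟨G.ends e, by simpa [ends] using hs.1 e⟩ : {a : Sym2 G.V // ¬ a.IsDiag}))
    fun a b h => hs.2 (Subtype.ext_iff.1 h)

/-- A simple 3-connected graph does not have exactly seven edges. -/
theorem card_edges_ne_seven (h3 : G.ThreeConnected) (hs : G.Simple) : Fintype.card G.E ≠ 7 := by
  intro h7
  have h1 := three_mul_ncard_le h3 hs Set.univ
  have h2 : G.inside Set.univ = Set.univ := by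
    ext
    simp [inside]
  have h4 : G.crossEdges Set.univ Set.univᶜ = ∅ := by
    ext
    simp [crossEdges]
  rw [h2, h4, Set.ncard_univ, Set.ncard_univ, Nat.card_eq_fintype_card,
    Nat.card_eq_fintype_card, h7, Set.ncard_empty] at h1
  have hV : Fintype.card G.V = 4 := by
    have := h3.1
    omega
  have := hs.card_edges_le
  rw [hV, h7] at this
  exact absurd this (by decide)

/-- A separation of order three of `G \ e` and `G / e` has a side with only two edges. -/
theorem ncard_eq_two_of_cycRank_le (h3 : G.ThreeConnected) (hs : G.Simple)
    (hsep : ∀ A : Set G.E, G.sepOrder A ≤ 3 → min A.ncard Aᶜ.ncard ≤ 3) {A B : Set G.E} {e : G.E}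
    (heA : e ∉ A) (hB : B = (insert e A)ᶜ) (hA2 : 2 ≤ A.ncard) (hB2 : 2 ≤ B.ncard)
    (h1 : G.cycRank (insert e A) + G.cycRank B ≤ Fintype.card G.V + 1)
    (h2 : G.cycRank A + G.cycRank (insert e B) ≤ Fintype.card G.V + 1) :
    A.ncard = 2 ∨ B.ncard = 2 := by
  have hAc : Aᶜ = insert e B := by
    subst hB
    ext f
    by_cases hf : f = e <;> simp [hf, heA]
  have heB : e ∉ B := by simp [hB]
  have hcA := Set.ncard_insert_of_notMem heA
  have hcB := Set.ncard_insert_of_notMem heB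
  have htot := Set.ncard_add_ncard_compl A
  rw [hAc, hcB, Nat.card_eq_fintype_card] at htot
  have h7 := card_edges_ne_seven h3 hs
  rw [hB] at h1
  rw [← hAc] at h2
  by_contra! hne
  by_cases hc : 4 ≤ B.ncard
  · have := hsep _ (sepOrder_le_three h3 hs h1 (by omega) (by rwa [← hB]))
    rw [← hB] at this
    omega
  · have := hsep _ (sepOrder_le_three h3 hs h2 (by omega) (by rw [hAc]; omega))
    rw [hAc] at this
    omega

/-- The ranks of two or three edges of a configuration and of their complement. -/
theorem cycRank_of_pair (h3 : G.ThreeConnected) (hs : G.Simple)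
    (hsep : ∀ A : Set G.E, G.sepOrder A ≤ 3 → min A.ncard Aᶜ.ncard ≤ 3) {S : Set G.E}
    (htri : ¬ ∃ e ∈ S, ∃ f ∈ S, ∃ g ∈ S, e ≠ f ∧ e ≠ g ∧ f ≠ g ∧
      ∃ a b c : G.V, a ≠ b ∧ a ≠ c ∧ b ≠ c ∧
        G.ends e = s(a, b) ∧ G.ends f = s(b, c) ∧ G.ends g = s(a, c))
    (hstar : ¬ ∃ v : G.V, G.degree v = 3 ∧ {e | G.inc v e} ⊆ S) {X : Set G.E} {e : G.E}
    (hX : X.ncard = 2) (hXS : X ⊆ S) (he : e ∈ S) (heX : e ∉ X) :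
    2 ≤ G.cycRank X ∧ 3 ≤ G.cycRank (insert e X) ∧ G.numComp (insert e X)ᶜ ≤ 1 := by
  refine ⟨?_, ?_, numComp_compl_le_one h3 hs hsep
    (by rw [Set.ncard_insert_of_notMem heX, hX]) fun ⟨v, hv, hvX⟩ =>
      hstar ⟨v, hv, hvX.trans (Set.insert_subset he hXS)⟩⟩
  all_goals
    obtain ⟨b, a, hba, rfl⟩ := Set.ncard_eq_two.1 hX
  · exact two_le_cycRank_pair hs hba.symm
  · simp only [Set.mem_insert_iff, Set.mem_singleton_iff, not_or] at heX
    refine three_le_cycRank_triple hs hba.symm (Ne.symm heX.2) (Ne.symm heX.1) ?_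
    rintro ⟨x, y, z, h⟩
    exact htri ⟨e, he, a, hXS (by simp), b, hXS (by simp), heX.2, heX.1, hba.symm, x, y, z, h⟩

/-- The connectivity between two pairs of edges of a configuration avoiding the fifth edge. -/
theorem connectivity_of_pairs (h3 : G.ThreeConnected) (hs : G.Simple)
    (hsep : ∀ A : Set G.E, G.sepOrder A ≤ 3 → min A.ncard Aᶜ.ncard ≤ 3) {S : Set G.E}
    (htri : ¬ ∃ e ∈ S, ∃ f ∈ S, ∃ g ∈ S, e ≠ f ∧ e ≠ g ∧ f ≠ g ∧
      ∃ a b c : G.V, a ≠ b ∧ a ≠ c ∧ b ≠ c ∧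
        G.ends e = s(a, b) ∧ G.ends f = s(b, c) ∧ G.ends g = s(a, c))
    (hstar : ¬ ∃ v : G.V, G.degree v = 3 ∧ {e | G.inc v e} ⊆ S) {X Y A B : Set G.E} {e : G.E}
    (hX : X.ncard = 2) (hY : Y.ncard = 2) (hXS : X ⊆ S) (hYS : Y ⊆ S) (he : e ∈ S)
    (heA : e ∉ A) (hB : B = (insert e A)ᶜ) (hXA : X ⊆ A) (hYB : Y ⊆ B) :
    Fintype.card G.V + 1 ≤ G.cycRank A + G.cycRank B ∧
      Fintype.card G.V + 2 ≤ G.cycRank (insert e A) + G.cycRank (insert e B) := by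
  have heB : e ∉ B := by simp [hB]
  have hA : A = (insert e B)ᶜ := by
    subst hB
    ext f
    by_cases hf : f = e <;> simp [hf, heA]
  obtain ⟨hX2, hX3, hXc⟩ := cycRank_of_pair h3 hs hsep htri hstar hX hXS he fun h => heA (hXA h)
  obtain ⟨hY2, hY3, hYc⟩ := cycRank_of_pair h3 hs hsep htri hstar hY hYS he fun h => heB (hYB h)
  have hA1 : G.cycRank A ≤ G.cycRank (insert e A) := cycRank_mono (Set.subset_insert _ _)
  have hB1 : G.cycRank B ≤ G.cycRank (insert e B) := cycRank_mono (Set.subset_insert _ _)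
  have hA2 := cycRank_insert_le e A
  have hB2 := cycRank_insert_le e B
  by_contra hcon
  have hcase := ncard_eq_two_of_cycRank_le h3 hs hsep heA hB
    (hX ▸ Set.ncard_le_ncard hXA) (hY ▸ Set.ncard_le_ncard hYB) (by omega) (by omega)
  rcases hcase with hc | hc
  · obtain rfl := Set.eq_of_subset_of_ncard_le hXA (by omega)
    rw [← hB] at hXc
    simp only [cycRank] at *
    omega
  · obtain rfl := Set.eq_of_subset_of_ncard_le hYB (by omega)
    rw [← hA] at hYc
    simp only [cycRank] at *
    omega

end Multigraph

theorem stmt8 (G : Multigraph) (hs : G.Simple) (h3 : G.ThreeConnected)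
    (hsep : ∀ A : Set G.E, G.sepOrder A ≤ 3 → min A.ncard Aᶜ.ncard ≤ 3)
    (S : Set G.E) (hS : S.ncard = 5)
    (htri : ¬ ∃ e ∈ S, ∃ f ∈ S, ∃ g ∈ S, e ≠ f ∧ e ≠ g ∧ f ≠ g ∧
      ∃ a b c : G.V, a ≠ b ∧ a ≠ c ∧ b ≠ c ∧
        G.ends e = s(a, b) ∧ G.ends f = s(b, c) ∧ G.ends g = s(a, c))
    (hstar : ¬ ∃ v : G.V, G.degree v = 3 ∧ {e | G.inc v e} ⊆ S) :
    ¬ G.ConfigSplits S := by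
  rintro ⟨I, J, K, ⟨rfl, hcfg⟩, hzero⟩
  have : Nonempty G.V := Fintype.card_pos_iff.1 (lt_of_lt_of_le (by norm_num) h3.1)
  obtain ⟨v0⟩ := this
  have hV : ∀ A, G.cycRank A ≤ Fintype.card G.V - 1 :=
    have : Nonempty G.V := ⟨v0⟩
    cycRank_le_card_sub_one
  refine absurd (hzero v0) ?_
  rcases hcfg with ⟨hI, hJ, hK, hIJ, hIK, hJK⟩ | ⟨hI, hJ, rfl, hIJ⟩
  · obtain ⟨e, rfl⟩ := Set.ncard_eq_one.1 hK
    have heI : e ∉ I := fun h => hIK.le ⟨h, rfl⟩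
    have heJ : e ∉ J := fun h => hJK.le ⟨h, rfl⟩
    have hd : ∀ f ∈ I, f ∉ J := fun f h h' => hIJ.le ⟨h, h'⟩
    have hX : I \ J = I := by
      ext f
      have := hd f
      simp only [Set.mem_sdiff]
      tauto
    have hY : J \ I = J := by
      ext f
      have := hd f
      simp only [Set.mem_sdiff]
      tauto
    refine dodgson_ne_zero_of_connectivity (by rw [hI, hJ]) (by rw [hX, hI])
      (by rw [cycRank_singleton hs, hK, Nat.cast_one]) (by simp [heI, heJ]) ?_ v0 fun A hA => ?_
    · rw [hIJ]
      exact numComp_compl_le_one h3 hs hsep (by simp) fun ⟨v, hv, h⟩ =>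
        hstar ⟨v, hv, h.trans (Set.empty_subset _)⟩
    · have hnot : ∀ f ∈ A, f ≠ e ∧ f ∉ I ∧ f ∉ J := fun f hf => by
        simpa using hA hf
      have hc := (connectivity_of_pairs (A := A ∪ I)
        (B := ((I ∪ J ∪ {e})ᶜ \ A) ∪ J) (e := e) h3 hs hsep htri hstar hI hJ
        (fun f hf => by simp [hf]) (fun f hf => by simp [hf]) (by simp)
        (by grind) (by ext f; have := hnot f; have := hd f; simp; grind)
        Set.subset_union_right Set.subset_union_right).2
      have := hV ({e} ∪ (I ∪ J ∪ {e})ᶜ ∪ (I \ J) ∪ (J \ I))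
      rw [hX, hY] at this ⊢
      rw [cycRank_singleton hs, Set.union_assoc {e} A, Set.union_assoc {e} (_ \ A),
        Set.singleton_union (s := A ∪ I), Set.singleton_union (s := _ \ A ∪ J)]
      omega
  · obtain ⟨e, he⟩ := Set.ncard_eq_one.1 hIJ
    have hiff : ∀ f, f ∈ I ∧ f ∈ J ↔ f = e := fun f => by
      rw [← Set.mem_inter_iff, he, Set.mem_singleton_iff]
    have heIJ := (hiff e).2 rfl
    have hX : (I \ J).ncard = 2 := by
      have := Set.ncard_inter_add_ncard_sdiff_eq_ncard I J
      omega
    have hY : (J \ I).ncard = 2 := by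
      have := Set.ncard_inter_add_ncard_sdiff_eq_ncard J I
      rw [Set.inter_comm] at this
      omega
    refine dodgson_ne_zero_of_connectivity (by rw [hI, hJ]) hX (by simp [cycRank_empty])
      (by simp) ?_ v0 fun A hA => ?_
    · refine numComp_compl_le_one h3 hs hsep (by rw [hIJ]; norm_num) fun ⟨v, hv, h⟩ =>
        hstar ⟨v, hv, h.trans fun f hf => Or.inl (Or.inl hf.1)⟩
    · have hnot : ∀ f ∈ A, f ∉ I ∧ f ∉ J := fun f hf => by simpa using hA hf
      have hc := (connectivity_of_pairs (A := ∅ ∪ A ∪ (I \ J))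
        (B := ∅ ∪ ((I ∪ J ∪ ∅)ᶜ \ A) ∪ (J \ I)) (e := e) h3 hs hsep htri hstar hX hY
        (fun f hf => by simp [hf.1]) (fun f hf => by simp [hf.1]) (by simp [heIJ.1])
        (by grind) (by ext f; have := hnot f; have := hiff f; simp; grind)
        Set.subset_union_right Set.subset_union_right).1
      have := hV (∅ ∪ (I ∪ J ∪ ∅)ᶜ ∪ (I \ J) ∪ (J \ I))
      rw [cycRank_empty]
      omega
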